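/- Let a_n denote the number of affine permutations in the affine symmetric group S̃_n (n ≥ 2) avoiding the patterns 3412 and 4231, and let α be the unique real root of the polynomial 1−6t+8t²−4t³ (α ≈ 0.228155). Then a_n ∼ α^{−n} as n → ∞; that is, lim_{n→∞} a_n·α^n = 1. -/

import Mathlib

/-- `w` is an affine permutation of period `n`: it commutes with translation by `n`
and the sum of `w(1), …, w(n)` equals `1 + ⋯ + n`. -/
def IsAffinePerm (n : ℕ) (w : Equiv.Perm ℤ) : Prop :=
  (∀ i : ℤ, w (i + n) = w i + n) ∧
    (∑ i ∈ Finset.Icc (1 : ℤ) (n : ℤ), w i) = ∑ i ∈ Finset.Icc (1 : ℤ) (n : ℤ), i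

/-- `w` contains the pattern given by the list `p` (a permutation of `1, …, k` in
one-line notation): there are indices `i₁ < ⋯ < i_k` whose values under `w` are in the
same relative order as the entries of `p`. -/
def ContainsPattern (w : Equiv.Perm ℤ) (p : List ℕ) : Prop :=
  ∃ f : Fin p.length → ℤ, StrictMono f ∧
    ∀ a b : Fin p.length, w (f a) < w (f b) ↔ p.get a < p.get b

/-- `w` avoids the patterns `3412` and `4231`. -/
def AvoidsBoth (w : Equiv.Perm ℤ) : Prop :=
  ¬ ContainsPattern w [3, 4, 1, 2] ∧ ¬ ContainsPattern w [4, 2, 3, 1]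

/-- The number of affine permutations in `S̃ₙ` avoiding `3412` and `4231`. -/
noncomputable def smoothCount (n : ℕ) : ℕ :=
  Nat.card {w : Equiv.Perm ℤ // IsAffinePerm n w ∧ AvoidsBoth w}

open Filter Topology

/-- The tail sequence of a probability distribution `p` on the natural numbers. -/
noncomputable def renewalTail (p : ℕ → ℝ) (j : ℕ) : ℝ := 1 - ∑ k ∈ Finset.range (j + 1), p k

lemma renewalTail_succ (p : ℕ → ℝ) (j : ℕ) :
    renewalTail p (j + 1) = renewalTail p j - p (j + 1) := by
  simp only [renewalTail, Finset.sum_range_succ _ (j + 1)]; ring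

lemma renewalTail_nonneg {p : ℕ → ℝ} (hp : ∀ k, 0 ≤ p k) (h1 : HasSum p 1) (j : ℕ) :
    0 ≤ renewalTail p j := by
  have := sum_le_hasSum (Finset.range (j + 1)) (fun k _ => hp k) h1
  simp only [renewalTail]; linarith

lemma renewalTail_le {p : ℕ → ℝ} (h1 : HasSum p 1) {C θ : ℝ} (hθ : 0 ≤ θ) (hθ1 : θ < 1)
    (hb : ∀ k, p k ≤ C * θ ^ k) (j : ℕ) : renewalTail p j ≤ C * (θ / (1 - θ)) * θ ^ j := by
  have h2 : HasSum (fun k => p (k + (j + 1))) (renewalTail p j) := by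
    have := (hasSum_nat_add_iff' (f := p) (j + 1)).2 h1
    exact this
  have h3 : HasSum (fun k => C * θ ^ (j + 1) * θ ^ k) (C * θ ^ (j + 1) * (1 - θ)⁻¹) :=
    (hasSum_geometric_of_lt_one hθ hθ1).mul_left _
  have := hasSum_le (fun k => ?_) h2 h3
  · calc _ ≤ _ := this
      _ = _ := by rw [pow_succ]; ring
  · calc _ ≤ _ := hb _
      _ = _ := by ring

lemma hasSum_renewalTail {p : ℕ → ℝ} (hp : ∀ k, 0 ≤ p k) (h1 : HasSum p 1)
    {C θ : ℝ} (hθ : 0 ≤ θ) (hθ1 : θ < 1) (hb : ∀ k, p k ≤ C * θ ^ k) :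
    HasSum (fun k : ℕ => k * p k) (∑' j, renewalTail p j) ∧ Summable (renewalTail p) := by
  have hs : Summable (renewalTail p) :=
    Summable.of_nonneg_of_le (renewalTail_nonneg hp h1) (renewalTail_le h1 hθ hθ1 hb)
      ((summable_geometric_of_lt_one hθ hθ1).mul_left _)
  refine ⟨?_, hs⟩
  have key : ∀ N : ℕ, ∑ j ∈ Finset.range N, renewalTail p j
      = ∑ k ∈ Finset.range (N + 1), k * p k + N * renewalTail p N := by
    intro N
    induction N with
    | zero => simp
    | succ N ih =>
      rw [Finset.sum_range_succ, ih, Finset.sum_range_succ _ (N + 1), renewalTail_succ]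
      push_cast; ring
  have hN : Tendsto (fun N : ℕ => N * renewalTail p N) atTop (𝓝 0) := by
    have h0 := tendsto_self_mul_const_pow_of_lt_one hθ hθ1
    have h0' := h0.const_mul (C * (θ / (1 - θ)))
    rw [mul_zero] at h0'
    refine squeeze_zero (fun N => mul_nonneg N.cast_nonneg (renewalTail_nonneg hp h1 N))
      (fun N => ?_) h0'
    calc _ ≤ N * (C * (θ / (1 - θ)) * θ ^ N) :=
          mul_le_mul_of_nonneg_left (renewalTail_le h1 hθ hθ1 hb N) N.cast_nonneg
      _ = _ := by ring
  have h2 : Tendsto (fun N : ℕ => ∑ k ∈ Finset.range (N + 1), k * p k) atTop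
      (𝓝 (∑' j, renewalTail p j)) := by
    have := hs.hasSum.tendsto_sum_nat.sub hN
    rw [sub_zero] at this
    refine this.congr (fun N => ?_)
    rw [key]; ring
  rw [hasSum_iff_tendsto_nat_of_nonneg (fun k => mul_nonneg k.cast_nonneg (hp k))]
  exact (tendsto_add_atTop_iff_nat (f := fun N => ∑ k ∈ Finset.range N, (k : ℝ) * p k) 1).1 h2

lemma renewal_sum_tail {p r : ℕ → ℝ} (hp0 : p 0 = 0) (hr0 : r 0 = 1)
    (hr : ∀ n, r (n + 1) = ∑ k ∈ Finset.range (n + 1), p (k + 1) * r (n - k)) (n : ℕ) :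
    ∑ j ∈ Finset.range (n + 1), renewalTail p j * r (n - j) = 1 := by
  induction n with
  | zero => simp [renewalTail, hp0, hr0]
  | succ n ih =>
    rw [Finset.sum_range_succ']
    have : ∑ k ∈ Finset.range (n + 1), renewalTail p (k + 1) * r (n + 1 - (k + 1))
        = ∑ k ∈ Finset.range (n + 1), renewalTail p k * r (n - k) - r (n + 1) := by
      rw [hr, ← Finset.sum_sub_distrib]
      refine Finset.sum_congr rfl (fun k _ => ?_)
      rw [renewalTail_succ, Nat.add_sub_add_right]; ring
    rw [this, ih]
    simp [renewalTail, hp0]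

lemma tendsto_conv {F : Filter ℕ} (hF : F ≤ atTop) {a r l : ℕ → ℝ} (ha : Summable a)
    (ha0 : ∀ k, 0 ≤ a k) (hr : ∀ n, r n ∈ Set.Icc (0 : ℝ) 1)
    (hl : ∀ i, Tendsto (fun n => r (n - i)) F (𝓝 (l i))) :
    Tendsto (fun n => ∑ k ∈ Finset.range (n + 1), a k * r (n - k)) F (𝓝 (∑' k, a k * l k)) := by
  have := tendsto_tsum_of_dominated_convergence (𝓕 := F)
    (f := fun n k => if k ∈ Finset.range (n + 1) then a k * r (n - k) else 0)
    (g := fun k => a k * l k) ha (fun k => ?_) (Eventually.of_forall fun n k => ?_)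
  · refine this.congr (fun n => ?_)
    rw [tsum_eq_sum (s := Finset.range (n + 1)) (fun k hk => by simp only [hk]; rfl)]
    exact Finset.sum_congr rfl (fun k hk => by simp only [hk]; rfl)
  · have h1 : ∀ᶠ n in F, k ∈ Finset.range (n + 1) :=
      ((eventually_ge_atTop k).mono (fun n hn => by simp; omega)).filter_mono hF
    refine ((hl k).const_mul (a k)).congr' (h1.mono fun n hn => ?_)
    simp only [hn, if_true]
  · split_ifs
    · rw [Real.norm_of_nonneg (mul_nonneg (ha0 k) (hr _).1)]
      exact mul_le_of_le_one_right (ha0 k) (hr _).2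
    · simpa using ha0 k

/-- The limit of a renewal sequence along an ultrafilter is stationary. -/
lemma renewal_extremal {p r : ℕ → ℝ} (hp0 : p 0 = 0) (hp : ∀ k, 0 ≤ p k) (hp1 : 0 < p 1)
    (h1 : HasSum p 1) (hs : Summable (renewalTail p)) (hr0 : r 0 = 1)
    (hr : ∀ n, r (n + 1) = ∑ k ∈ Finset.range (n + 1), p (k + 1) * r (n - k))
    (hrm : ∀ n, r n ∈ Set.Icc (0 : ℝ) 1)
    {x : ℝ} (hx : MapClusterPt x atTop r) (ε : ℝ) (hε : ε = 1 ∨ ε = -1)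
    (hmax : ∀ y, MapClusterPt y atTop r → ε * y ≤ ε * x) :
    (∑' j, renewalTail p j) * x = 1 := by
  obtain ⟨U, hU, hUx⟩ := mapClusterPt_iff_ultrafilter.1 hx
  have hex : ∀ i, ∃ l, Tendsto (fun n => r (n - i)) U (𝓝 l) := by
    intro i
    obtain ⟨l, -, hl⟩ := (isCompact_Icc (a := (0:ℝ)) (b := 1)).ultrafilter_le_nhds
      (U.map (fun n => r (n - i))) (by
        simp only [Ultrafilter.coe_map, le_principal_iff, mem_map]
        exact Eventually.of_forall (fun n => hrm (n - i)))
    exact ⟨l, hl⟩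
  choose l hl using hex
  have hl0 : l 0 = x := tendsto_nhds_unique (hl 0) (by simpa using hUx)
  have hlc : ∀ i, MapClusterPt (l i) atTop r := by
    intro i
    refine mapClusterPt_iff_ultrafilter.2 ⟨U.map (fun n => n - i), ?_, ?_⟩
    · exact (tendsto_sub_atTop_nat i).mono_left hU
    · exact hl i
  have hlm : ∀ i, ε * l i ≤ ε * x := fun i => hmax _ (hlc i)
  have hle : ∀ i, l i ∈ Set.Icc (0 : ℝ) 1 := fun i =>
    isClosed_Icc.mem_of_tendsto (hl i) (Eventually.of_forall fun n => hrm _)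
  have hp' : ∀ n, 1 ≤ n → r n = ∑ k ∈ Finset.range (n + 1), p k * r (n - k) := by
    intro n hn
    obtain ⟨m, rfl⟩ := Nat.exists_eq_add_of_le' hn
    rw [Finset.sum_range_succ', hr]; simp [hp0]
  have hrec : ∀ i, l i = ∑' k, p k * l (i + k) := by
    intro i
    have h2 := tendsto_conv ((tendsto_sub_atTop_nat i).mono_left hU) (F := (U : Filter ℕ).map (fun n => n - i))
      h1.summable hp hrm (l := fun k => l (i + k)) (fun k => by
        rw [tendsto_map'_iff]
        refine (hl (i + k)).congr (fun n => ?_)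
        simp [Nat.sub_sub])
    rw [tendsto_map'_iff] at h2
    refine tendsto_nhds_unique (hl i) (h2.congr' ?_)
    have : ∀ᶠ n in (U : Filter ℕ), i + 1 ≤ n := (eventually_ge_atTop (i + 1)).filter_mono hU
    filter_upwards [this] with n hn
    exact (hp' (n - i) (by omega)).symm
  have hsl : ∀ i, Summable (fun k => p k * l (i + k)) := fun i =>
    Summable.of_nonneg_of_le (fun k => mul_nonneg (hp k) (hle _).1)
      (fun k => mul_le_of_le_one_right (hp k) (hle _).2) h1.summable
  have hall : ∀ i, l i = x := by
    intro i
    induction i with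
    | zero => exact hl0
    | succ i ih =>
      have e1 : HasSum (fun k => p k * (ε * x - ε * l (i + k))) 0 := by
        have a1 := h1.mul_right (ε * x)
        have a2 := ((hsl i).hasSum).mul_left ε
        rw [← hrec, ih] at a2
        have a3 := a1.sub a2
        rw [one_mul, sub_self] at a3
        refine Eq.subst (motive := fun f => HasSum f (0 : ℝ)) (funext fun k => ?_) a3
        ring
      have e2 := (hasSum_zero_iff_of_nonneg (fun k => mul_nonneg (hp k) (sub_nonneg.2 (hlm _)))).1 e1
      have e3 := congrFun e2 1
      simp only [Pi.zero_apply, mul_eq_zero, hp1.ne', false_or] at e3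
      rcases hε with rfl | rfl <;> linarith
  have h3 := tendsto_conv hU hs (renewalTail_nonneg hp h1) hrm hl
  have h4 : ∀ n, ∑ k ∈ Finset.range (n + 1), renewalTail p k * r (n - k) = 1 :=
    renewal_sum_tail hp0 hr0 hr
  simp only [h4, hall] at h3
  rw [← tsum_mul_right]
  exact tendsto_nhds_unique h3 tendsto_const_nhds

/-- A form of the renewal theorem, for distributions with exponentially small tails. -/
theorem renewal_tendsto {p r : ℕ → ℝ} (hp0 : p 0 = 0) (hp : ∀ k, 0 ≤ p k) (hp1 : 0 < p 1)
    (h1 : HasSum p 1) {C θ : ℝ} (hθ : 0 ≤ θ) (hθ1 : θ < 1) (hb : ∀ k, p k ≤ C * θ ^ k)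
    (hr0 : r 0 = 1)
    (hr : ∀ n, r (n + 1) = ∑ k ∈ Finset.range (n + 1), p (k + 1) * r (n - k)) :
    Tendsto (fun n => ∑ k ∈ Finset.range (n + 1), k * p k * r (n - k)) atTop (𝓝 1) := by
  obtain ⟨hm, hs⟩ := hasSum_renewalTail hp h1 hθ hθ1 hb
  have hrn : ∀ n, 0 ≤ r n := by
    intro n
    induction n using Nat.strong_induction_on with
    | _ n ih =>
      cases n with
      | zero => simp [hr0]
      | succ n =>
        rw [hr]
        exact Finset.sum_nonneg fun k _ => mul_nonneg (hp _) (ih _ (by omega))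
  have hrm : ∀ n, r n ∈ Set.Icc (0 : ℝ) 1 := by
    refine fun n => ⟨hrn n, ?_⟩
    rw [← renewal_sum_tail hp0 hr0 hr n, Finset.sum_range_succ']
    have : renewalTail p 0 = 1 := by simp [renewalTail, hp0]
    rw [this, Nat.sub_zero, one_mul]
    have := Finset.sum_nonneg (s := Finset.range n)
      (f := fun k => renewalTail p (k + 1) * r (n - (k + 1)))
      fun k _ => mul_nonneg (renewalTail_nonneg hp h1 _) (hrn _)
    linarith
  set K : Set ℝ := {x | MapClusterPt x atTop r} with hK
  have hKsub : K ⊆ Set.Icc 0 1 := by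
    intro x hx
    obtain ⟨U, hU, hUx⟩ := mapClusterPt_iff_ultrafilter.1 hx
    exact isClosed_Icc.mem_of_tendsto hUx (Eventually.of_forall fun n => hrm _)
  have hKc : IsCompact K :=
    isCompact_Icc.of_isClosed_subset isClosed_setOfPred_clusterPt hKsub
  have hKn : K.Nonempty := by
    obtain ⟨x, -, hx⟩ := (isCompact_Icc (a := (0:ℝ)) (b := 1)).exists_mapClusterPt (f := atTop)
      (u := r) (by simpa using ⟨0, fun n _ => hrm n⟩)
    exact ⟨x, hx⟩
  obtain ⟨M, hMK, hM⟩ := hKc.exists_isGreatest hKn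
  obtain ⟨m, hmK, hmin⟩ := hKc.exists_isLeast hKn
  have eM := renewal_extremal hp0 hp hp1 h1 hs hr0 hr hrm hMK 1 (Or.inl rfl)
    (fun y hy => by simpa using hM hy)
  have em := renewal_extremal hp0 hp hp1 h1 hs hr0 hr hrm hmK (-1) (Or.inr rfl)
    (fun y hy => by simpa using hmin hy)
  have hMm : M = m := by
    have h0 : (∑' j, renewalTail p j) ≠ 0 := by
      intro h; simp [h] at eM
    exact mul_left_cancel₀ h0 (eM.trans em.symm)
  have hlim : Tendsto r atTop (𝓝 M) := by
    refine isCompact_Icc.tendsto_nhds_of_unique_mapClusterPt (Eventually.of_forall hrm) ?_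
    intro y _ hy
    exact le_antisymm (hM hy) (hMm ▸ hmin hy)
  have h5 := tendsto_conv (F := atTop) le_rfl hm.summable
    (fun k => mul_nonneg k.cast_nonneg (hp k)) hrm (l := fun _ => M)
    (fun i => hlim.comp (tendsto_sub_atTop_nat i))
  rwa [tsum_mul_right, hm.tsum_eq, eM] at h5

/-- The potential on the generating tree: the discounted number of descendants of a node. -/
noncomputable def treePotential (r : ℝ) (t s : ℕ) : ℝ := (r ^ t + r ^ (s + 1) - r ^ 2) / (1 + r - r ^ 2)

lemma sum_Icc_two_pow (r : ℝ) (hr : r ≠ 1) (t : ℕ) (ht : 1 ≤ t) :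
    ∑ y ∈ Finset.Icc 2 t, r ^ y = (r ^ (t + 1) - r ^ 2) / (r - 1) := by
  have h : r - 1 ≠ 0 := sub_ne_zero.2 hr
  induction t, ht using Nat.le_induction with
  | base => simp
  | succ t ht ih =>
    rw [Finset.sum_Icc_succ_top (by omega), ih]
    field_simp
    ring

lemma treePotential_one (r : ℝ) (y : ℕ) :
    treePotential r y 1 = r ^ y / (1 + r - r ^ 2) := by
  simp [treePotential]

lemma treePotential_eq {r a : ℝ} (hr : 1 < r) (ha : a = (r - 1) / r ^ 2) (hr2 : 0 < 1 + r - r ^ 2)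
    (t s : ℕ) (ht : 1 ≤ t) :
    treePotential r t s = 1 + a * (∑ y ∈ Finset.Icc 2 t, treePotential r y 1
      + treePotential r (t + 1) (s + 1) + ∑ y ∈ Finset.Icc 2 (s + 1), treePotential r y 1) := by
  have h1 : r - 1 ≠ 0 := by linarith
  have h2 : r ≠ 0 := by linarith
  simp only [treePotential_one, ← Finset.sum_div]
  rw [sum_Icc_two_pow r hr.ne' t ht, sum_Icc_two_pow r hr.ne' (s + 1) (by omega), ha]
  simp only [treePotential]
  field_simp
  ring

lemma treePotential_lower {r : ℝ} (hr : 1 < r) (hr2 : 0 < 1 + r - r ^ 2)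
    (t s : ℕ) (ht : 1 ≤ t) :
    (1 - r / 2) * (r ^ t + r ^ (s + 1)) ≤ treePotential r t s * (1 + r - r ^ 2) := by
  rw [treePotential, div_mul_cancel₀ _ hr2.ne']
  have h1 : r ≤ r ^ t := le_self_pow₀ hr.le (by omega)
  have h2 : r ≤ r ^ (s + 1) := le_self_pow₀ hr.le (by omega)
  nlinarith

section Tree

variable {β : Type*} (A : ℕ → Finset β) (t s : ℕ → β → ℕ)

/-- The rule by which the nodes of the generating tree produce children. -/
def TreeRule : Prop := A 1 = ∅ ∧ (∀ n, ∀ w ∈ A n, 1 ≤ t n w) ∧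
  ∀ (n : ℕ), 1 ≤ n → ∀ f : ℕ → ℕ → ℝ,
    ∑ w ∈ A (n + 1), f (t (n + 1) w) (s (n + 1) w) =
      ∑ w ∈ A n, (∑ y ∈ Finset.Icc 2 (t n w), f y 1 + f (t n w + 1) (s n w + 1)
        + ∑ y ∈ Finset.Icc 2 (s n w + 1), f y 1) + ∑ y ∈ Finset.Icc 2 n, f y 1

variable {A t s}

lemma TreeRule.step (h : TreeRule A t s) {r a : ℝ} (hr : 1 < r) (ha : a = (r - 1) / r ^ 2)
    (hr2 : 0 < 1 + r - r ^ 2) (n : ℕ) (hn : 1 ≤ n) :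
    a * ∑ w ∈ A (n + 1), treePotential r (t (n + 1) w) (s (n + 1) w) =
      ∑ w ∈ A n, treePotential r (t n w) (s n w) - (A n).card
        + (1 - 1 / r) / (r * (1 + r - r ^ 2)) * (r ^ (n + 1) - r ^ 2) / (r - 1) := by
  have e := h.2.2 n hn (treePotential r)
  rw [e, mul_add, Finset.mul_sum]
  have : ∑ w ∈ A n, treePotential r (t n w) (s n w) - (A n).card
      = ∑ w ∈ A n, (treePotential r (t n w) (s n w) - 1) := by
    rw [Finset.sum_sub_distrib]; simp
  rw [this]
  congr 1
  · refine Finset.sum_congr rfl fun w hw => ?_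
    rw [treePotential_eq hr ha hr2 _ _ (h.2.1 n w hw)]; ring
  · simp only [treePotential_one, ← Finset.sum_div]
    rw [sum_Icc_two_pow r hr.ne' n hn, ha]
    have : r - 1 ≠ 0 := by linarith
    have : r ≠ 0 := by linarith
    field_simp

/-- The tree grows at most at rate `1 / a`. -/
lemma TreeRule.bound (h : TreeRule A t s) {r a : ℝ} (hr : 1 < r) (ha : a = (r - 1) / r ^ 2)
    (hr2 : 0 < 1 + r - r ^ 2) :
    ∃ K : ℝ, ∀ n, 1 ≤ n → a ^ n * ∑ w ∈ A n, treePotential r (t n w) (s n w) ≤ K := by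
  have hr0 : r ≠ 0 := by linarith
  have h1r : 0 < r - 1 := by linarith
  have hpos : 0 < a := by rw [ha]; positivity
  refine ⟨1 / (1 + r - r ^ 2), fun n hn => ?_⟩
  have key : ∀ n, 1 ≤ n → a ^ n * ∑ w ∈ A n, treePotential r (t n w) (s n w)
      ≤ 1 / (1 + r - r ^ 2) * (1 - (a * r) ^ n) := by
    intro n hn
    induction n, hn using Nat.le_induction with
    | base =>
      rw [h.1, Finset.sum_empty, mul_zero]
      refine mul_nonneg (by positivity) ?_
      rw [ha]; field_simp; nlinarith
    | succ n hn ih =>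
      rw [pow_succ, mul_assoc, h.step hr ha hr2 n hn]
      have e1 : a ^ n * (∑ w ∈ A n, treePotential r (t n w) (s n w) - (A n).card) ≤
          a ^ n * ∑ w ∈ A n, treePotential r (t n w) (s n w) := by
        refine mul_le_mul_of_nonneg_left ?_ (by positivity)
        linarith [Nat.cast_nonneg (α := ℝ) (A n).card]
      have e2 : a ^ n * ((1 - 1 / r) / (r * (1 + r - r ^ 2)) * (r ^ (n + 1) - r ^ 2) / (r - 1))
          ≤ 1 / (1 + r - r ^ 2) * ((a * r) ^ n * (1 / r)) := by
        have e3 : (1 - 1 / r) / (r * (1 + r - r ^ 2)) * (r ^ (n + 1) - r ^ 2) / (r - 1)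
            = 1 / (1 + r - r ^ 2) * (1 / r) * (r ^ n - r) := by
          field_simp
          ring
        rw [e3, mul_pow]
        have : (0:ℝ) < a ^ n * (1 / (1 + r - r ^ 2) * (1 / r)) * r := by positivity
        nlinarith
      have e4 : (a * r) ^ (n + 1) = (a * r) ^ n * (1 - 1 / r) := by
        rw [pow_succ, ha]; field_simp
      rw [mul_add]
      calc _ ≤ 1 / (1 + r - r ^ 2) * (1 - (a * r) ^ n)
            + 1 / (1 + r - r ^ 2) * ((a * r) ^ n * (1 / r)) := by linarith
        _ = _ := by rw [e4]; ring
  refine (key n hn).trans (mul_le_of_le_one_right (by positivity) ?_)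
  have : 0 ≤ (a * r) ^ n := by positivity
  linarith

lemma TreeRule.card_bound (h : TreeRule A t s) {r a : ℝ} (hr : 1 < r) (ha : a = (r - 1) / r ^ 2)
    (hr2 : 0 < 1 + r - r ^ 2) :
    ∃ K : ℝ, ∀ n, 1 ≤ n → ∑ w ∈ A n, (r ^ (t n w) + r ^ (s n w + 1)) ≤ K * (1 / a) ^ n := by
  obtain ⟨K, hK⟩ := h.bound hr ha hr2
  have h2 : r < 2 := by nlinarith
  have h1r : 0 < r - 1 := by linarith
  have hpos : 0 < a := by rw [ha]; positivity
  have hq : 0 < 1 - r / 2 := by linarith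
  refine ⟨K * ((1 + r - r ^ 2) / (1 - r / 2)), fun n hn => ?_⟩
  have e1 : (1 - r / 2) * ∑ w ∈ A n, (r ^ (t n w) + r ^ (s n w + 1)) ≤
      (∑ w ∈ A n, treePotential r (t n w) (s n w)) * (1 + r - r ^ 2) := by
    rw [Finset.mul_sum, Finset.sum_mul]
    exact Finset.sum_le_sum fun w hw => treePotential_lower hr hr2 _ _ (h.2.1 n w hw)
  have e2 : ∑ w ∈ A n, treePotential r (t n w) (s n w) ≤ K * (1 / a) ^ n := by
    have := hK n hn
    rw [one_div, inv_pow, ← div_eq_mul_inv, le_div_iff₀ (by positivity)]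
    linarith
  rw [mul_assoc, mul_comm (_ / _), ← mul_assoc, mul_div_assoc', le_div_iff₀ hq]
  nlinarith

/-- The real root of `r³ - 2 r² + 2 r - 2`. -/
lemma exists_ratio : ∃ r : ℝ, 3 / 2 < r ∧ r < 25 / 16 ∧ r ^ 3 - 2 * r ^ 2 + 2 * r - 2 = 0 := by
  have := intermediate_value_Ioo (a := (3 / 2 : ℝ)) (b := 25 / 16) (by norm_num)
    (f := fun r => r ^ 3 - 2 * r ^ 2 + 2 * r - 2) (by fun_prop)
  obtain ⟨r, hr, h0⟩ := this (show (0:ℝ) ∈ _ by constructor <;> norm_num)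
  exact ⟨r, hr.1, hr.2, h0⟩

lemma ratio_root {r a : ℝ} (hr : 3 / 2 < r) (h : r ^ 3 - 2 * r ^ 2 + 2 * r - 2 = 0)
    (ha : a = (r - 1) / r ^ 2) : 1 - 6 * a + 8 * a ^ 2 - 4 * a ^ 3 = 0 := by
  have hr0 : r ≠ 0 := by linarith
  have : r ^ 3 = 2 * r ^ 2 - 2 * r + 2 := by linarith
  rw [ha]; field_simp
  linear_combination (r ^ 3 - 4 * r ^ 2 + 4 * r - 2) * h

theorem TreeRule.hasSum (h : TreeRule A t s) {r a : ℝ} (hr : 3 / 2 < r) (hr' : r < 25 / 16)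
    (h0 : r ^ 3 - 2 * r ^ 2 + 2 * r - 2 = 0) (ha : a = (r - 1) / r ^ 2) :
    HasSum (fun n : ℕ => a ^ (n + 1) * (2 * (A (n + 1)).card + 1)) 1 := by
  have hr1 : 1 < r := by linarith
  have hr2 : 0 < 1 + r - r ^ 2 := by nlinarith
  have hrp : 0 < r := by linarith
  have h1r : 0 < r - 1 := by linarith
  have hpos : 0 < a := by rw [ha]; positivity
  obtain ⟨K, hK⟩ := h.card_bound (r := 25 / 16) (a := 144 / 625) (by norm_num) (by norm_num)
    (by norm_num)
  set b := 1 / (1 + r - r ^ 2) with hb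
  have hlim : Tendsto (fun n => a ^ n * ∑ w ∈ A n, treePotential r (t n w) (s n w)) atTop (𝓝 0) := by
    have haa : a * (625 / 144) < 1 := by
      rw [ha, div_mul_eq_mul_div, div_lt_one (by positivity)]
      nlinarith
    have hg := (tendsto_pow_atTop_nhds_zero_of_lt_one (r := a * (625 / 144)) (by positivity) haa).const_mul
      (b * K)
    rw [mul_zero] at hg
    refine squeeze_zero' ?_ ?_ hg
    · refine Eventually.of_forall fun n => mul_nonneg (by positivity) (Finset.sum_nonneg fun w hw => ?_)
      have := treePotential_lower hr1 hr2 (t n w) (s n w) (h.2.1 n w hw)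
      have e : 0 ≤ (1 - r / 2) * (r ^ t n w + r ^ (s n w + 1)) := 
        mul_nonneg (by linarith) (by positivity)
      exact nonneg_of_mul_nonneg_left (e.trans this) hr2
    · filter_upwards [eventually_ge_atTop 1] with n hn
      have e1 : ∑ w ∈ A n, treePotential r (t n w) (s n w) ≤
          b * ∑ w ∈ A n, ((25/16 : ℝ) ^ (t n w) + (25/16) ^ (s n w + 1)) := by
        rw [Finset.mul_sum]
        refine Finset.sum_le_sum fun w hw => ?_
        rw [treePotential, hb, one_div, inv_mul_eq_div]
        refine div_le_div_of_nonneg_right ?_ hr2.le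
        have i1 : r ^ t n w ≤ (25/16 : ℝ) ^ t n w := pow_le_pow_left₀ hrp.le hr'.le _
        have i2 : r ^ (s n w + 1) ≤ (25/16 : ℝ) ^ (s n w + 1) := pow_le_pow_left₀ hrp.le hr'.le _
        nlinarith
      calc _ ≤ a ^ n * (b * (K * (1 / (144 / 625)) ^ n)) := by
            refine mul_le_mul_of_nonneg_left (e1.trans ?_) (by positivity)
            exact mul_le_mul_of_nonneg_left (hK n hn) (by positivity)
        _ = _ := by rw [mul_pow]; norm_num; ring
  have har : a * r < 1 := by rw [ha]; field_simp; nlinarith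
  have ha1 : a < 1 := by nlinarith
  have key : ∀ N : ℕ, ∑ n ∈ Finset.range N, a ^ (n + 1) * ((A (n + 1)).card : ℝ) =
      - (a ^ (N + 1) * ∑ w ∈ A (N + 1), treePotential r (t (N + 1) w) (s (N + 1) w)) +
      ∑ n ∈ Finset.range N, b * a * ((a * r) ^ n - a ^ n) := by
    intro N
    induction N with
    | zero => simp [h.1]
    | succ N ih =>
      rw [Finset.sum_range_succ, ih, Finset.sum_range_succ]
      have e1 := h.step hr1 ha hr2 (N + 1) (by omega)
      have e2 : a ^ (N + 1 + 1) * ∑ w ∈ A (N + 1 + 1),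
            treePotential r (t (N + 1 + 1) w) (s (N + 1 + 1) w) =
          a ^ (N + 1) * (a * ∑ w ∈ A (N + 1 + 1),
            treePotential r (t (N + 1 + 1) w) (s (N + 1 + 1) w)) := by ring
      have e3 : (1 - 1 / r) / (r * (1 + r - r ^ 2)) * (r ^ (N + 1 + 1) - r ^ 2) / (r - 1)
          = b * (r ^ N - 1) := by
        rw [hb]
        have : r - 1 ≠ 0 := h1r.ne'
        field_simp
        ring
      rw [e2, e1, e3, mul_pow]
      ring
  have hg1 : HasSum (fun n : ℕ => b * a * ((a * r) ^ n - a ^ n))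
      (b * a * ((1 - a * r)⁻¹ - (1 - a)⁻¹)) :=
    ((hasSum_geometric_of_lt_one (by positivity) har).sub
      (hasSum_geometric_of_lt_one hpos.le ha1)).mul_left _
  have hg2 : HasSum (fun n : ℕ => a ^ (n + 1)) (a * (1 - a)⁻¹) := by
    simpa only [pow_succ'] using (hasSum_geometric_of_lt_one hpos.le ha1).mul_left a
  have hc : HasSum (fun n : ℕ => a ^ (n + 1) * ((A (n + 1)).card : ℝ))
      (b * a * ((1 - a * r)⁻¹ - (1 - a)⁻¹)) := by
    rw [hasSum_iff_tendsto_nat_of_nonneg (fun n => by positivity)]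
    have := ((tendsto_add_atTop_iff_nat 1).2 hlim).neg.add hg1.tendsto_sum_nat
    rw [neg_zero, zero_add] at this
    exact this.congr fun N => (key N).symm
  have hsum := (hc.mul_left 2).add hg2
  have hval : 2 * (b * a * ((1 - a * r)⁻¹ - (1 - a)⁻¹)) + a * (1 - a)⁻¹ = 1 := by
    have e1 : 1 - a * r = 1 / r := by rw [ha]; field_simp; ring
    have e2 : 1 - a = (r ^ 2 - r + 1) / r ^ 2 := by rw [ha]; field_simp; ring
    have e3 : 0 < r ^ 2 - r + 1 := by nlinarith
    rw [e1, e2, hb, ha]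
    field_simp
    linear_combination (r ^ 2 - r + 1) * h0
  rw [hval] at hsum
  refine Eq.subst (motive := fun f => HasSum f (1 : ℝ)) (funext fun n => ?_) hsum
  ring

/-- An explicit exponential bound on the number of nodes. -/
lemma TreeRule.card_le (h : TreeRule A t s) :
    ∃ K : ℝ, ∀ n, 1 ≤ n → (2 * (A n).card + 1 : ℝ) ≤ K * (625 / 144) ^ n := by
  obtain ⟨K, hK⟩ := h.card_bound (r := 25 / 16) (a := 144 / 625) (by norm_num) (by norm_num)
    (by norm_num)
  refine ⟨K + 1, fun n hn => ?_⟩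
  have e1 : (2 * (A n).card : ℝ) ≤ ∑ w ∈ A n, ((25 / 16 : ℝ) ^ t n w + (25 / 16) ^ (s n w + 1)) := by
    have : ∑ w ∈ A n, (2 : ℝ) ≤ _ := Finset.sum_le_sum fun w (_ : w ∈ A n) =>
      show (2 : ℝ) ≤ (25 / 16 : ℝ) ^ t n w + (25 / 16) ^ (s n w + 1) by
        have a1 : (1 : ℝ) ≤ (25 / 16 : ℝ) ^ t n w := one_le_pow₀ (by norm_num)
        have a2 : (1 : ℝ) ≤ (25 / 16 : ℝ) ^ (s n w + 1) := one_le_pow₀ (by norm_num)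
        linarith
    simpa [mul_comm] using this
  have e2 : (1 : ℝ) ≤ (625 / 144) ^ n := one_le_pow₀ (by norm_num)
  have := hK n hn
  norm_num at this
  linarith

end Tree

lemma perm_apply_inv {β : Type*} (w : Equiv.Perm β) (x : β) : w (w⁻¹ x) = x := w.apply_symm_apply x

lemma perm_inv_apply {β : Type*} (w : Equiv.Perm β) (x : β) : w⁻¹ (w x) = x := w.symm_apply_apply x

/-- Elementwise form of the avoidance of `3412` and `4231`. -/
def SmoothPerm (w : Equiv.Perm ℤ) : Prop :=
  ∀ a b c d : ℤ, a < b → b < c → c < d →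
    ¬(w c < w d ∧ w d < w a ∧ w a < w b) ∧ ¬(w d < w b ∧ w b < w c ∧ w c < w a)

/-- `w` fixes everything outside `{1, …, n}`. -/
def SuppIn (n : ℕ) (w : Equiv.Perm ℤ) : Prop := ∀ i : ℤ, i < 1 ∨ n < i → w i = i

lemma SmoothPerm.inv {w : Equiv.Perm ℤ} (h : SmoothPerm w) : SmoothPerm w⁻¹ := by
  intro a b c d hab hbc hcd
  refine ⟨fun ⟨h1, h2, h3⟩ => ?_, fun ⟨h1, h2, h3⟩ => ?_⟩
  · exact (h _ _ _ _ h1 h2 h3).1 (by simpa using ⟨hab, hbc, hcd⟩)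
  · exact (h _ _ _ _ h1 h2 h3).2 (by simpa using ⟨hab, hbc, hcd⟩)

lemma SuppIn.inv {n : ℕ} {w : Equiv.Perm ℤ} (h : SuppIn n w) : SuppIn n w⁻¹ := by
  intro i hi
  rw [Equiv.Perm.inv_eq_iff_eq, h i hi]

lemma SuppIn.bounds {n : ℕ} {w : Equiv.Perm ℤ} (h : SuppIn n w) {i : ℤ} (h1 : 1 ≤ i) (h2 : i ≤ n) :
    1 ≤ w i ∧ w i ≤ n := by
  by_contra hc
  have := h (w i) (by omega)
  have := w.injective this
  omega

lemma SuppIn.inversion {n : ℕ} {w : Equiv.Perm ℤ} (h : SuppIn n w) {i j : ℤ} (hij : i < j)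
    (hw : w j < w i) : (1 ≤ i ∧ i ≤ n) ∧ (1 ≤ j ∧ j ≤ n) := by
  by_cases hi : 1 ≤ i ∧ i ≤ n <;> by_cases hj : 1 ≤ j ∧ j ≤ n
  · exact ⟨hi, hj⟩
  · have := h.bounds hi.1 hi.2
    have := h j (by omega)
    omega
  · have := h.bounds hj.1 hj.2
    have := h i (by omega)
    omega
  · have := h i (by omega)
    have := h j (by omega)
    omega

/-- Transfer of smoothness along an order preserving map of positions. -/
lemma SmoothPerm.transfer {u w : Equiv.Perm ℤ} (hw : SmoothPerm w) (P : ℤ → Prop) (f : ℤ → ℤ)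
    (hP : ∀ i j, i < j → u j < u i → P i ∧ P j) (hf : ∀ i j, P i → P j → i < j → f i < f j)
    (hu : ∀ i j, P i → P j → u i < u j → w (f i) < w (f j)) : SmoothPerm u := by
  intro a b c d hab hbc hcd
  refine ⟨fun ⟨h1, h2, h3⟩ => ?_, fun ⟨h1, h2, h3⟩ => ?_⟩
  · obtain ⟨pa, pc⟩ := hP a c (by omega) (by omega)
    obtain ⟨pb, pd⟩ := hP b d (by omega) (by omega)
    exact (hw _ _ _ _ (hf _ _ pa pb hab) (hf _ _ pb pc hbc) (hf _ _ pc pd hcd)).1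
      ⟨hu _ _ pc pd h1, hu _ _ pd pa h2, hu _ _ pa pb h3⟩
  · obtain ⟨pa, pc⟩ := hP a c (by omega) (by omega)
    obtain ⟨pb, pd⟩ := hP b d (by omega) (by omega)
    exact (hw _ _ _ _ (hf _ _ pa pb hab) (hf _ _ pb pc hbc) (hf _ _ pc pd hcd)).2
      ⟨hu _ _ pd pb h1, hu _ _ pb pc h2, hu _ _ pc pa h3⟩

lemma avoidsBoth_iff (w : Equiv.Perm ℤ) : AvoidsBoth w ↔ SmoothPerm w := by
  constructor
  · intro ⟨h1, h2⟩ a b c d hab hbc hcd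
    refine ⟨fun ⟨e1, e2, e3⟩ => h1 ⟨![a, b, c, d], ?_, ?_⟩, fun ⟨e1, e2, e3⟩ =>
      h2 ⟨![a, b, c, d], ?_, ?_⟩⟩
    · refine Fin.strictMono_iff_lt_succ.2 fun i => ?_
      change Fin 3 at i
      fin_cases i <;> simp <;> assumption
    · intro x y
      change Fin 4 at x y
      fin_cases x <;> fin_cases y <;> simp <;> omega
    · refine Fin.strictMono_iff_lt_succ.2 fun i => ?_
      change Fin 3 at i
      fin_cases i <;> simp <;> assumption
    · intro x y
      change Fin 4 at x y
      fin_cases x <;> fin_cases y <;> simp <;> omega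
  · intro h
    refine ⟨fun ⟨f, hf, e⟩ => ?_, fun ⟨f, hf, e⟩ => ?_⟩
    · change Fin 4 → ℤ at f
      refine (h (f 0) (f 1) (f 2) (f 3) (hf (by decide)) (hf (by decide)) (hf (by decide))).1
        ⟨(e 2 3).2 (by decide), (e 3 0).2 (by decide), (e 0 1).2 (by decide)⟩
    · change Fin 4 → ℤ at f
      refine (h (f 0) (f 1) (f 2) (f 3) (hf (by decide)) (hf (by decide)) (hf (by decide))).2
        ⟨(e 3 1).2 (by decide), (e 1 2).2 (by decide), (e 2 0).2 (by decide)⟩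

lemma finite_suppIn (n : ℕ) : {w | SuppIn n w}.Finite := by
  have : Finite {f : Equiv.Perm ℤ // ∀ a : ℤ, ¬ (1 ≤ a ∧ a ≤ n) → f a = a} := by
    have : Finite {a : ℤ // 1 ≤ a ∧ a ≤ n} := (Set.finite_Icc (1 : ℤ) n).to_subtype
    exact Finite.of_equiv _ (Equiv.Perm.subtypeEquivSubtypePerm fun a : ℤ => 1 ≤ a ∧ a ≤ n)
  have : Finite {w // SuppIn n w} := Finite.of_injective
    (β := {f : Equiv.Perm ℤ // ∀ a : ℤ, ¬ (1 ≤ a ∧ a ≤ n) → f a = a})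
    (fun w => ⟨w.1, fun a ha => w.2 a (by omega)⟩)
    (fun a b h => Subtype.ext (congrArg (fun x => x.1) h))
  exact Set.finite_coe_iff.1 this

/-- A perm supported in `{1, …, n}` mapping an initial segment to itself preserves it. -/
lemma SuppIn.preserves {n : ℕ} {w : Equiv.Perm ℤ} (h : SuppIn n w) {k : ℤ}
    (hk : ∀ j ≤ k, w j ≤ k) (j : ℤ) : w j ≤ k ↔ j ≤ k := by
  refine ⟨fun hj => ?_, hk j⟩
  have hmap : (Finset.Icc (min 0 (min k (w j))) k).image w ⊆ Finset.Icc (min 0 (min k (w j))) k := by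
    intro x hx
    obtain ⟨y, hy, rfl⟩ := Finset.mem_image.1 hx
    rw [Finset.mem_Icc] at hy ⊢
    refine ⟨?_, hk y hy.2⟩
    by_cases hy1 : 1 ≤ y ∧ y ≤ n
    · have := (h.bounds hy1.1 hy1.2).1; omega
    · rw [h y (by omega)]; exact hy.1
  have heq := Finset.eq_of_subset_of_card_le hmap
    (by rw [Finset.card_image_of_injective _ w.injective])
  have : w j ∈ (Finset.Icc (min 0 (min k (w j))) k).image w := by
    rw [heq, Finset.mem_Icc]; omega
  obtain ⟨y, hy, e⟩ := Finset.mem_image.1 this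
  rw [← w.injective e]
  exact (Finset.mem_Icc.1 hy).2

/-- Indecomposable smooth permutations of `{1, …, n}`. -/
structure IsInd (n : ℕ) (w : Equiv.Perm ℤ) : Prop where
  supp : SuppIn n w
  smooth : SmoothPerm w
  noCut : ∀ k : ℤ, 1 ≤ k → k < n → ∃ j ≤ k, k < w j

lemma IsInd.inv {n : ℕ} {w : Equiv.Perm ℤ} (h : IsInd n w) : IsInd n w⁻¹ := by
  refine ⟨h.supp.inv, h.smooth.inv, fun k h1 h2 => ?_⟩
  by_contra! hc
  obtain ⟨j, hj, hj2⟩ := h.noCut k h1 h2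
  have := (h.supp.inv.preserves hc (w j)).1 (by simpa using hj)
  omega

/-- The set of indecomposable smooth permutations of `{1, …, n}`. -/
noncomputable def indSet (n : ℕ) : Finset (Equiv.Perm ℤ) :=
  Set.Finite.toFinset (s := {w | IsInd n w}) ((finite_suppIn n).subset fun _ h => IsInd.supp h)

lemma mem_indSet {n : ℕ} {w : Equiv.Perm ℤ} : w ∈ indSet n ↔ IsInd n w := by
  simp [indSet]

/-- `w` is decreasing on the last `r` positions of `{1, …, n}`. -/
def DecTail (n : ℕ) (w : Equiv.Perm ℤ) (r : ℕ) : Prop :=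
  ∀ i j : ℤ, (n : ℤ) - r < i → i < j → j ≤ n → w j < w i

open Classical in
/-- The length of the longest decreasing tail of `w`. -/
noncomputable def tailLen (n : ℕ) (w : Equiv.Perm ℤ) : ℕ := Nat.findGreatest (DecTail n w) n

lemma DecTail.mono {n r s : ℕ} {w : Equiv.Perm ℤ} (h : DecTail n w s) (hrs : r ≤ s) :
    DecTail n w r := fun i j hi hij hj => h i j (by omega) hij hj

lemma decTail_one (n : ℕ) (w : Equiv.Perm ℤ) : DecTail n w 1 := fun i j _ _ _ => by omega

lemma tailLen_le (n : ℕ) (w : Equiv.Perm ℤ) : tailLen n w ≤ n := by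
  classical
  exact Nat.findGreatest_le n

lemma le_tailLen {n r : ℕ} {w : Equiv.Perm ℤ} (hr : r ≤ n) : r ≤ tailLen n w ↔ DecTail n w r := by
  classical
  constructor
  · intro h
    have : DecTail n w (tailLen n w) := by
      unfold tailLen
      exact Nat.findGreatest_spec (P := DecTail n w) (m := 0) (Nat.zero_le _)
        ((decTail_one n w).mono (by omega))
    exact this.mono h
  · intro h
    unfold tailLen
    convert Nat.le_findGreatest hr h

lemma decTail_tailLen (n : ℕ) (w : Equiv.Perm ℤ) : DecTail n w (tailLen n w) :=
  (le_tailLen (tailLen_le n w)).1 le_rfl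

lemma one_le_tailLen {n : ℕ} (hn : 1 ≤ n) (w : Equiv.Perm ℤ) : 1 ≤ tailLen n w :=
  (le_tailLen hn).2 (decTail_one n w)

/-- `w` decreases from the position of `n` on. -/
def DecAfterMax (n : ℕ) (w : Equiv.Perm ℤ) : Prop :=
  ∀ i j : ℤ, w⁻¹ n ≤ i → i < j → j ≤ n → w j < w i

lemma sub_le_of_decreasing {f : ℤ → ℤ} {a b : ℤ} (h : ∀ i j, a ≤ i → i < j → j ≤ b → f j < f i)
    (hab : a ≤ b) : f b ≤ f a - (b - a) := by
  obtain ⟨k, rfl⟩ : ∃ k : ℕ, b = a + k := ⟨(b - a).toNat, by omega⟩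
  induction k with
  | zero => simp
  | succ k ih =>
    have h1 := ih (fun i j hi hij hj => h i j hi hij (by push_cast; omega)) (by omega)
    have h2 := h (a + k) (a + (k + 1 : ℕ)) (by omega) (by push_cast; omega) le_rfl
    push_cast at *
    omega

section Basic

variable {n : ℕ} {w : Equiv.Perm ℤ}

lemma SuppIn.posMax (h : SuppIn n w) (hn : 1 ≤ n) : 1 ≤ w⁻¹ (n : ℤ) ∧ w⁻¹ (n : ℤ) ≤ n :=
  h.inv.bounds (by omega) le_rfl

lemma SuppIn.le_of_le (h : SuppIn n w) {i : ℤ} (hi : i ≤ n) : w i ≤ n := by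
  by_cases h1 : 1 ≤ i
  · exact (h.bounds h1 hi).2
  · rw [h i (by omega)]; exact hi

lemma DecAfterMax.tailLen_eq (hd : DecAfterMax n w) (h : SuppIn n w) (hn : 1 ≤ n) :
    (tailLen n w : ℤ) = n + 1 - w⁻¹ (n : ℤ) := by
  obtain ⟨h1, h2⟩ := h.posMax hn
  obtain ⟨r, hr⟩ : ∃ r : ℕ, (r : ℤ) = n + 1 - w⁻¹ (n : ℤ) := ⟨(n + 1 - w⁻¹ (n : ℤ)).toNat, by omega⟩
  have e1 : r ≤ tailLen n w := (le_tailLen (by omega)).2 fun i j hi hij hj =>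
    hd i j (by omega) hij hj
  have e2 : ¬ r + 1 ≤ tailLen n w := by
    intro hc
    have hle := tailLen_le n w
    have := (le_tailLen (by omega)).1 hc (w⁻¹ (n : ℤ) - 1) (w⁻¹ (n : ℤ)) (by push_cast; omega)
      (by omega) h2
    rw [perm_apply_inv] at this
    have := h.le_of_le (i := w⁻¹ (n : ℤ) - 1) (by omega)
    omega
  omega

/-- Either a smooth permutation or its inverse decreases after its maximum. -/
lemma SmoothPerm.decAfterMax (hs : SmoothPerm w) (h : SuppIn n w) :
    DecAfterMax n w ∨ DecAfterMax n w⁻¹ := by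
  have key : ∀ v : Equiv.Perm ℤ, SmoothPerm v → SuppIn n v → ¬ DecAfterMax n v →
      ∃ x, v⁻¹ (n : ℤ) < x ∧ x < n ∧ v x < v n := by
    intro v hv hvs hc
    unfold DecAfterMax at hc
    push Not at hc
    obtain ⟨i, j, hi, hij, hj, hw⟩ := hc
    have hd := hvs.le_of_le hj
    have hlt : v i < v j := lt_of_le_of_ne hw fun e => by have := v.injective e; omega
    have hi' : v⁻¹ (n : ℤ) < i := by
      refine lt_of_le_of_ne hi fun e => ?_
      rw [← e, perm_apply_inv] at hlt
      omega
    refine ⟨i, hi', by omega, ?_⟩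
    by_contra hcon
    rcases eq_or_lt_of_le hj with e | hjn
    · rw [e] at hlt; omega
    have hne : v n ≠ v i := fun e => by have := v.injective e; omega
    refine (hv _ _ _ _ hi' hij hjn).2 ⟨by omega, hlt, ?_⟩
    rw [perm_apply_inv]
    refine lt_of_le_of_ne hd fun e => ?_
    have : v⁻¹ (n : ℤ) = j := by rw [Equiv.Perm.inv_eq_iff_eq, e]
    omega
  by_contra! hc
  obtain ⟨x, hx1, hx2, hx3⟩ := key w hs h hc.1
  obtain ⟨y, hy1, hy2, hy3⟩ := key w⁻¹ hs.inv h.inv hc.2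
  rw [inv_inv] at hy1
  exact (hs _ _ _ _ hy3 hx1 hx2).1 (by simpa using ⟨hx3, hy1, hy2⟩)

/-- The reversal of `{1, …, n}`. -/
def revPerm (n : ℕ) : Equiv.Perm ℤ where
  toFun i := if 1 ≤ i ∧ i ≤ n then n + 1 - i else i
  invFun i := if 1 ≤ i ∧ i ≤ n then n + 1 - i else i
  left_inv i := by dsimp only; split_ifs <;> omega
  right_inv i := by dsimp only; split_ifs <;> omega

lemma revPerm_apply (n : ℕ) (i : ℤ) : revPerm n i = if 1 ≤ i ∧ i ≤ n then n + 1 - i else i := rfl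

lemma revPerm_inv (n : ℕ) : (revPerm n)⁻¹ = revPerm n := rfl

lemma isInd_revPerm (n : ℕ) : IsInd n (revPerm n) := by
  refine ⟨fun i hi => ?_, fun a b c d _ _ _ => ?_, fun k h1 h2 => ⟨1, h1, ?_⟩⟩
  · rw [revPerm_apply, if_neg (by omega)]
  · simp only [revPerm_apply]
    split_ifs <;> omega
  · rw [revPerm_apply, if_pos (by omega)]; omega

lemma decAfterMax_revPerm (n : ℕ) (hn : 1 ≤ n) : DecAfterMax n (revPerm n) := by
  intro i j hi hij hj
  rw [revPerm_inv, revPerm_apply, if_pos (by omega)] at hi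
  rw [revPerm_apply, revPerm_apply, if_pos (by omega), if_pos (by omega)]
  omega

lemma SuppIn.eq_revPerm (h : SuppIn n w) (hd : ∀ i j : ℤ, 1 ≤ i → i < j → j ≤ n → w j < w i) :
    w = revPerm n := by
  ext i
  rw [revPerm_apply]
  split_ifs with hi
  · have h1 := sub_le_of_decreasing (f := w) (a := 1) (b := i)
      (fun a b ha hab hb => hd a b ha hab (by omega)) hi.1
    have h2 := sub_le_of_decreasing (f := w) (a := i) (b := n)
      (fun a b ha hab hb => hd a b (by omega) hab hb) hi.2
    have h3 := h.bounds (i := 1) le_rfl (by omega)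
    have h4 := h.bounds (i := n) (by omega) le_rfl
    omega
  · exact h i (by omega)

lemma IsInd.eq_revPerm (h : IsInd n w) (h1 : DecAfterMax n w) (h2 : DecAfterMax n w⁻¹) :
    w = revPerm n := by
  rcases Nat.eq_zero_or_pos n with rfl | hn
  · exact h.supp.eq_revPerm fun i j hi hij hj => by simp at hj; omega
  obtain ⟨d1, d2⟩ := h.supp.posMax hn
  have e0 : w⁻¹⁻¹ (n : ℤ) = w n := by rw [inv_inv]
  have a1 := sub_le_of_decreasing h1 d2
  have a2 := sub_le_of_decreasing h2 (h.supp.inv.posMax hn).2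
  rw [e0, perm_inv_apply] at a2
  rw [perm_apply_inv] at a1
  by_cases hd : w⁻¹ (n : ℤ) = 1
  · exact h.supp.eq_revPerm fun i j hi hij hj => h1 i j (by omega) hij hj
  exfalso
  obtain ⟨j, hj1, hj2⟩ := h.noCut (w⁻¹ (n : ℤ) - 1) (by omega) (by omega)
  have hj3 : w n ≤ w j := by omega
  rcases eq_or_lt_of_le hj3 with e | hlt
  · have := w.injective e; omega
  have hjn := h.supp.le_of_le (i := j) (by omega)
  rcases eq_or_lt_of_le hjn with e | hjn
  · have : w⁻¹ (n : ℤ) = j := by rw [Equiv.Perm.inv_eq_iff_eq, e]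
    omega
  have := h2 (w j) n (by rw [inv_inv]; omega) hjn le_rfl
  rw [perm_inv_apply] at this
  omega

end Basic

/-- The cycle moving `n + 1` to the position `n + 1 - r` and shifting the last `r` positions. -/
def insCycle (n r : ℕ) : Equiv.Perm ℤ where
  toFun i := if i = n + 1 - r then n + 1 else if (n : ℤ) + 1 - r < i ∧ i ≤ n + 1 then i - 1 else i
  invFun i := if i = n + 1 then n + 1 - r else if (n : ℤ) + 1 - r ≤ i ∧ i ≤ n then i + 1 else i
  left_inv i := by dsimp only; split_ifs <;> omega
  right_inv i := by dsimp only; split_ifs <;> omega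

/-- Insert a new maximum in front of the last `r` entries. -/
def insMax (n r : ℕ) (w : Equiv.Perm ℤ) : Equiv.Perm ℤ := w * insCycle n r

section Ins

variable {n r : ℕ} {w : Equiv.Perm ℤ} {i j : ℤ}

lemma insCycle_inv_apply : (insCycle n r)⁻¹ i =
    if i = n + 1 then (n : ℤ) + 1 - r else if (n : ℤ) + 1 - r ≤ i ∧ i ≤ n then i + 1 else i := rfl

lemma insMax_self (hw : SuppIn n w) : insMax n r w (n + 1 - r) = n + 1 := by
  have : insCycle n r (n + 1 - r) = n + 1 := by simp [insCycle]
  rw [insMax, Equiv.Perm.mul_apply, this, hw _ (by omega)]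

lemma insMax_lt (hi : i < n + 1 - r) : insMax n r w i = w i := by
  have : insCycle n r i = i := by simp only [insCycle, Equiv.coe_fn_mk]; split_ifs <;> omega
  rw [insMax, Equiv.Perm.mul_apply, this]

lemma insMax_gt (hi : (n : ℤ) + 1 - r < i) (hi2 : i ≤ n + 1) : insMax n r w i = w (i - 1) := by
  have : insCycle n r i = i - 1 := by simp only [insCycle, Equiv.coe_fn_mk]; split_ifs <;> omega
  rw [insMax, Equiv.Perm.mul_apply, this]

lemma insMax_inv_apply (x : ℤ) : (insMax n r w)⁻¹ x = (insCycle n r)⁻¹ (w⁻¹ x) := by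
  rw [insMax, mul_inv_rev, Equiv.Perm.mul_apply]

lemma insMax_inv_max (hw : SuppIn n w) : (insMax n r w)⁻¹ ((n + 1 : ℕ) : ℤ) = n + 1 - r := by
  rw [Equiv.Perm.inv_eq_iff_eq, insMax_self hw]; push_cast; rfl

lemma suppIn_insMax (hr : r ≤ n) (hw : SuppIn n w) : SuppIn (n + 1) (insMax n r w) := by
  intro i hi
  push_cast at hi
  have : insCycle n r i = i := by simp only [insCycle, Equiv.coe_fn_mk]; split_ifs <;> omega
  rw [insMax, Equiv.Perm.mul_apply, this, hw i (by omega)]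

lemma isInd_insMax (hw : IsInd n w) (hr1 : 1 ≤ r) (hr : r ≤ n) (hd : DecTail n w r) :
    IsInd (n + 1) (insMax n r w) ∧ DecAfterMax (n + 1) (insMax n r w) := by
  have hs := suppIn_insMax hr hw.supp
  have hdec : ∀ i j : ℤ, (n : ℤ) + 1 - r < i → i < j → j ≤ n + 1 →
      insMax n r w j < insMax n r w i := by
    intro i j h1 h2 h3
    rw [insMax_gt h1 (by omega), insMax_gt (by omega) h3]
    exact hd _ _ (by omega) (by omega) (by omega)
  have hmax := insMax_self (r := r) hw.supp
  refine ⟨⟨hs, ?_, fun k h1 h2 => ?_⟩, fun i j hi hij hj => ?_⟩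
  · intro a b c d hab hbc hcd
    set u := insMax n r w with hu
    have htr : ∀ x y : ℤ, x ≤ n + 1 → x ≠ n + 1 - r → y ≤ n + 1 → y ≠ n + 1 - r → x < y →
        insCycle n r x < insCycle n r y := by
      intro x y h1 h2 h3 h4 h5
      simp only [insCycle, Equiv.coe_fn_mk]
      split_ifs <;> omega
    have happ : ∀ x, u x = w (insCycle n r x) := fun x => rfl
    have hle : ∀ x : ℤ, x ≤ n + 1 → u x ≤ n + 1 := by
      intro x hx
      have := hs.le_of_le (i := x) (by push_cast; omega)
      push_cast at this; exact this
    refine ⟨fun ⟨h1, h2, h3⟩ => ?_, fun ⟨h1, h2, h3⟩ => ?_⟩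
    · have hd1 := (hs.inversion (i := b) (j := d) (by omega) (by omega)).2.2
      push_cast at hd1
      have eb := hle b (by omega)
      have na : a ≠ n + 1 - r := by rintro rfl; omega
      have nc : c ≠ n + 1 - r := by rintro rfl; omega
      have nd : d ≠ n + 1 - r := by rintro rfl; omega
      by_cases nb : b = n + 1 - r
      · have := hdec c d (by omega) hcd hd1
        omega
      exact (hw.smooth _ _ _ _ (htr a b (by omega) na (by omega) nb hab)
        (htr b c (by omega) nb (by omega) nc hbc) (htr c d (by omega) nc (by omega) nd hcd)).1
        ⟨h1, h2, h3⟩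
    · have hd1 := (hs.inversion (i := a) (j := d) (by omega) (by omega)).2.2
      push_cast at hd1
      have ea := hle a (by omega)
      have nb : b ≠ n + 1 - r := by rintro rfl; omega
      have nc : c ≠ n + 1 - r := by rintro rfl; omega
      have nd : d ≠ n + 1 - r := by rintro rfl; omega
      by_cases na : a = n + 1 - r
      · have := hdec b c (by omega) hbc (by omega)
        omega
      exact (hw.smooth _ _ _ _ (htr a b (by omega) na (by omega) nb hab)
        (htr b c (by omega) nb (by omega) nc hbc) (htr c d (by omega) nc (by omega) nd hcd)).2
        ⟨h1, h2, h3⟩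
  · push_cast at h2
    by_cases hk : (n : ℤ) + 1 - r ≤ k
    · exact ⟨_, hk, by rw [hmax]; exact h2⟩
    · obtain ⟨j, hj, hj2⟩ := hw.noCut k h1 (by omega)
      exact ⟨j, hj, by rwa [insMax_lt (by omega)]⟩
  · rw [insMax_inv_max hw.supp] at hi
    push_cast at hj
    rcases eq_or_lt_of_le hi with e | h
    · rw [← e, hmax, insMax_gt (by omega) hj]
      have := hw.supp.le_of_le (i := j - 1) (by omega)
      omega
    · exact hdec i j h hij hj

/-- Removing the maximum from an indecomposable permutation decreasing after its maximum. -/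
lemma exists_insMax (hn : 1 ≤ n) {u : Equiv.Perm ℤ} (hu : IsInd (n + 1) u)
    (hd : DecAfterMax (n + 1) u) :
    ∃ w r, IsInd n w ∧ 1 ≤ r ∧ r ≤ n ∧ DecTail n w r ∧ insMax n r w = u := by
  obtain ⟨p1, p2⟩ := hu.supp.posMax (by omega)
  push_cast at p1 p2
  set D : ℤ := u⁻¹ ((n : ℤ) + 1) with hD
  have huD : u D = n + 1 := by rw [hD, perm_apply_inv]
  obtain ⟨r, hr⟩ : ∃ r : ℕ, (r : ℤ) = n + 1 - D := ⟨(n + 1 - D).toNat, by omega⟩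
  have hDr : D = n + 1 - r := by omega
  have hd' : ∀ i j : ℤ, D ≤ i → i < j → j ≤ n + 1 → u j < u i := by
    intro i j hi hij hj
    exact hd i j (by push_cast; exact hi) hij (by push_cast; exact hj)
  have hr1 : 1 ≤ r := by
    by_contra hc
    obtain ⟨j, hj, hj2⟩ := hu.noCut n (by omega) (by push_cast; omega)
    have h3 := hu.supp.le_of_le (i := j) (by push_cast; omega)
    push_cast at h3
    have : u j = u D := by omega
    have := u.injective this
    omega
  set w := u * (insCycle n r)⁻¹ with hw
  have hins : insMax n r w = u := by rw [insMax, hw]; simp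
  have happ : ∀ x, w x = u ((insCycle n r)⁻¹ x) := fun x => rfl
  have hsupp : SuppIn n w := by
    intro i hi
    rw [happ, insCycle_inv_apply]
    split_ifs with h1 h2
    · rw [← hDr, huD, h1]
    · omega
    · exact hu.supp i (by push_cast; omega)
  have hlt : ∀ x, x < D → w x = u x := by
    intro x hx
    rw [happ, insCycle_inv_apply, if_neg (by omega), if_neg (by omega)]
  have hge : ∀ x, D ≤ x → x ≤ n → w x = u (x + 1) := by
    intro x hx hx2
    rw [happ, insCycle_inv_apply, if_neg (by omega), if_pos (by omega)]
  refine ⟨w, r, ⟨hsupp, ?_, fun k h1 h2 => ?_⟩, hr1, by omega, ?_, hins⟩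
  · refine hu.smooth.transfer (fun i => i ≤ n) (fun i => (insCycle n r)⁻¹ i) ?_ ?_ ?_
    · intro i j hij hwij
      have := hsupp.inversion hij hwij
      exact ⟨this.1.2, this.2.2⟩
    · intro i j hi hj hij
      simp only [insCycle_inv_apply]
      split_ifs <;> omega
    · intro i j hi hj hij
      exact hij
  · by_contra! hc
    have hpres := hsupp.preserves hc
    obtain ⟨j, hj, hj2⟩ := hu.noCut k h1 (by push_cast; omega)
    have hjD : D ≤ j := by
      by_contra hcon
      have := hc j hj
      rw [hlt j (by omega)] at this
      omega
    have e1 := hge n (by omega) le_rfl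
    have e2 := hpres n
    have e3 := sub_le_of_decreasing hd' p2
    omega
  · intro i j hi hij hj
    rw [hge i (by omega) (by omega), hge j (by omega) hj]
    exact hd' _ _ (by omega) (by omega) (by omega)

lemma insMax_inj {r' : ℕ} {w' : Equiv.Perm ℤ} (hw : SuppIn n w) (hw' : SuppIn n w')
    (h : insMax n r w = insMax n r' w') : w = w' ∧ r = r' := by
  have h1 := insMax_inv_max (r := r) hw
  rw [h, insMax_inv_max hw'] at h1
  have : r = r' := by omega
  subst this
  exact ⟨mul_right_cancel h, rfl⟩

lemma tailLen_insMax (hw : IsInd n w) (hr1 : 1 ≤ r) (hr : r ≤ n) (hd : DecTail n w r) :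
    tailLen (n + 1) (insMax n r w) = r + 1 := by
  obtain ⟨h1, h2⟩ := isInd_insMax hw hr1 hr hd
  have := h2.tailLen_eq h1.supp (by omega)
  rw [insMax_inv_max hw.supp] at this
  push_cast at this
  omega

lemma tailLen_insMax_inv (hw : IsInd n w) (hn : 1 ≤ n)
    (hd : w⁻¹ (n : ℤ) < n + 1 - r) : tailLen (n + 1) (insMax n r w)⁻¹ = 1 := by
  have h1 := one_le_tailLen (n := n + 1) (by omega) (insMax n r w)⁻¹
  by_contra hc
  have h2 : 2 ≤ tailLen (n + 1) (insMax n r w)⁻¹ := by omega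
  have := (le_tailLen (by omega)).1 h2 n ((n + 1 : ℕ) : ℤ) (by push_cast; omega)
    (by push_cast; omega) le_rfl
  rw [insMax_inv_max hw.supp, insMax_inv_apply, insCycle_inv_apply, if_neg (by omega),
    if_neg (by omega)] at this
  omega

lemma tailLen_insMax_inv' (hw : IsInd n w) (hn : 1 ≤ n)
    (hd : w⁻¹ (n : ℤ) = n + 1 - r) :
    tailLen (n + 1) (insMax n r w)⁻¹ = tailLen n w⁻¹ + 1 := by
  have key : ∀ x : ℕ, x ≤ n → (x + 1 ≤ tailLen (n + 1) (insMax n r w)⁻¹ ↔ x ≤ tailLen n w⁻¹) := by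
    intro x hx
    rw [le_tailLen (by omega), le_tailLen hx]
    constructor
    · intro h i j hi hij hj
      have := h i j (by push_cast; omega) hij (by push_cast; omega)
      simp only [insMax_inv_apply, insCycle_inv_apply] at this
      have b1 := hw.supp.inv.le_of_le (i := i) (by omega)
      have b2 := hw.supp.inv.le_of_le (i := j) (by omega)
      split_ifs at this <;> omega
    · intro h i j hi hij hj
      push_cast at hi hj
      have b1 := hw.supp.inv.le_of_le (i := i) (by omega)
      have hpos : w⁻¹ (n : ℤ) ≤ w⁻¹ i := by
        rcases eq_or_lt_of_le (show i ≤ n by omega) with e | hlt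
        · rw [e]
        · exact (h i n (by omega) hlt le_rfl).le
      rcases eq_or_lt_of_le hj with rfl | hj
      · have e := insMax_inv_max (r := r) hw.supp
        push_cast at e
        rw [e, insMax_inv_apply, insCycle_inv_apply, if_neg (by omega), if_pos (by omega)]
        omega
      · have := h i j (by omega) hij (by omega)
        rw [insMax_inv_apply, insMax_inv_apply, insCycle_inv_apply, insCycle_inv_apply]
        split_ifs <;> omega
  have l1 := tailLen_le n w⁻¹
  have l2 := tailLen_le (n + 1) (insMax n r w)⁻¹
  have l3 := one_le_tailLen (n := n + 1) (by omega) (insMax n r w)⁻¹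
  have k1 := (key _ l1).2 le_rfl
  have k2 := (key (tailLen (n + 1) (insMax n r w)⁻¹ - 1) (by omega)).1 (by omega)
  omega

end Ins

open Classical in
/-- The nodes of the generating tree of indecomposable smooth permutations. -/
noncomputable def treeNodes (n : ℕ) : Finset (Equiv.Perm ℤ) :=
  ((indSet n).filter (DecAfterMax n)).erase (revPerm n)

lemma mem_treeNodes {n : ℕ} {w : Equiv.Perm ℤ} :
    w ∈ treeNodes n ↔ w ≠ revPerm n ∧ IsInd n w ∧ DecAfterMax n w := by
  classical
  simp [treeNodes, mem_indSet]

lemma mem_indSet_cases {n : ℕ} {w : Equiv.Perm ℤ} (hw : IsInd n w) :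
    w = revPerm n ∨ w ∈ treeNodes n ∨ w⁻¹ ∈ treeNodes n := by
  by_cases h0 : w = revPerm n
  · exact Or.inl h0
  right
  rcases hw.smooth.decAfterMax hw.supp with h | h
  · exact Or.inl (mem_treeNodes.2 ⟨h0, hw, h⟩)
  · refine Or.inr (mem_treeNodes.2 ⟨fun e => h0 ?_, hw.inv, h⟩)
    rw [← inv_inv w, e, revPerm_inv]

lemma sum_indSet {n : ℕ} (G : Equiv.Perm ℤ → ℝ) :
    ∑ w ∈ indSet n, G w = ∑ w ∈ treeNodes n, (G w + G w⁻¹) + G (revPerm n) := by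
  classical
  have e : indSet n = insert (revPerm n) (treeNodes n ∪ (treeNodes n).image (·⁻¹)) := by
    ext w
    simp only [Finset.mem_insert, Finset.mem_union, Finset.mem_image, mem_indSet]
    constructor
    · intro h
      rcases mem_indSet_cases h with h | h | h
      · exact Or.inl h
      · exact Or.inr (Or.inl h)
      · exact Or.inr (Or.inr ⟨_, h, inv_inv w⟩)
    · rintro (rfl | h | ⟨v, h, rfl⟩)
      · exact isInd_revPerm n
      · exact (mem_treeNodes.1 h).2.1
      · exact (mem_treeNodes.1 h).2.1.inv
  have hdisj : Disjoint (treeNodes n) ((treeNodes n).image (·⁻¹)) := by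
    rw [Finset.disjoint_left]
    intro w h1 h2
    obtain ⟨v, hv, rfl⟩ := Finset.mem_image.1 h2
    obtain ⟨a1, a2, a3⟩ := mem_treeNodes.1 hv
    obtain ⟨b1, b2, b3⟩ := mem_treeNodes.1 h1
    exact a1 (a2.eq_revPerm a3 b3)
  rw [e, Finset.sum_insert, Finset.sum_union hdisj, Finset.sum_image (by simp),
    Finset.sum_add_distrib, add_comm]
  simp only [Finset.mem_union, Finset.mem_image, not_or, not_exists, not_and]
  refine ⟨fun h => (mem_treeNodes.1 h).1 rfl, fun v hv e => (mem_treeNodes.1 hv).1 ?_⟩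
  rw [← inv_inv v, e, revPerm_inv]

lemma card_indSet (n : ℕ) : ((indSet n).card : ℝ) = 2 * (treeNodes n).card + 1 := by
  have := sum_indSet (n := n) fun _ => 1
  simp only [Finset.sum_const, nsmul_eq_mul, mul_one] at this
  rw [this]; ring

lemma sum_treeNodes_succ {n : ℕ} (hn : 1 ≤ n) (F : Equiv.Perm ℤ → ℝ) :
    ∑ u ∈ treeNodes (n + 1), F u =
      ∑ w ∈ indSet n, ∑ r ∈ Finset.Icc 1 (tailLen n w), F (insMax n r w)
        - F (revPerm (n + 1)) := by
  classical
  have e : ∑ u ∈ (indSet (n + 1)).filter (DecAfterMax (n + 1)), F u =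
      ∑ w ∈ indSet n, ∑ r ∈ Finset.Icc 1 (tailLen n w), F (insMax n r w) := by
    rw [Finset.sum_sigma']
    symm
    refine Finset.sum_bij (fun x _ => insMax n x.2 x.1) ?_ ?_ ?_ (fun _ _ => rfl)
    · rintro ⟨w, r⟩ h
      simp only [Finset.mem_sigma, mem_indSet, Finset.mem_Icc] at h
      have hr := h.2.2.trans (tailLen_le n w)
      rw [Finset.mem_filter, mem_indSet]
      exact isInd_insMax h.1 h.2.1 hr ((le_tailLen hr).1 h.2.2)
    · rintro ⟨w, r⟩ h ⟨w', r'⟩ h' heq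
      simp only [Finset.mem_sigma, mem_indSet, Finset.mem_Icc] at h h'
      obtain ⟨rfl, rfl⟩ := insMax_inj h.1.supp h'.1.supp heq
      rfl
    · intro u hu
      rw [Finset.mem_filter, mem_indSet] at hu
      obtain ⟨w, r, h1, h2, h3, h4, h5⟩ := exists_insMax hn hu.1 hu.2
      refine ⟨⟨w, r⟩, ?_, h5⟩
      simp only [Finset.mem_sigma, mem_indSet, Finset.mem_Icc]
      exact ⟨h1, h2, (le_tailLen h3).2 h4⟩
  rw [treeNodes, Finset.sum_erase_eq_sub, e]
  rw [Finset.mem_filter, mem_indSet]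
  exact ⟨isInd_revPerm _, decAfterMax_revPerm _ (by omega)⟩

lemma sum_Icc_one_shift (g : ℕ → ℝ) (m : ℕ) :
    ∑ r ∈ Finset.Icc 1 m, g (r + 1) = ∑ y ∈ Finset.Icc 2 (m + 1), g y := by
  induction m with
  | zero => simp
  | succ m ih =>
    rw [Finset.sum_Icc_succ_top (by omega), ih, Finset.sum_Icc_succ_top (b := m + 1) (by omega)]

section Children

variable {n : ℕ} {w : Equiv.Perm ℤ} (f : ℕ → ℕ → ℝ)

lemma sum_children_of_lt (hw : IsInd n w) (hn : 1 ≤ n) {m : ℕ} (hm : m ≤ tailLen n w)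
    (hlt : w⁻¹ (n : ℤ) < n + 1 - m) :
    ∑ r ∈ Finset.Icc 1 m, f (tailLen (n + 1) (insMax n r w)) (tailLen (n + 1) (insMax n r w)⁻¹) =
      ∑ y ∈ Finset.Icc 2 (m + 1), f y 1 := by
  rw [← sum_Icc_one_shift fun y => f y 1]
  refine Finset.sum_congr rfl fun r hr => ?_
  rw [Finset.mem_Icc] at hr
  have hrn := (hr.2.trans hm).trans (tailLen_le n w)
  rw [tailLen_insMax hw hr.1 hrn ((le_tailLen hrn).1 (hr.2.trans hm)),
    tailLen_insMax_inv hw hn (by omega)]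

lemma sum_children_of_decAfterMax (hw : IsInd n w) (hn : 1 ≤ n) (hd : DecAfterMax n w) :
    ∑ r ∈ Finset.Icc 1 (tailLen n w),
        f (tailLen (n + 1) (insMax n r w)) (tailLen (n + 1) (insMax n r w)⁻¹) =
      ∑ y ∈ Finset.Icc 2 (tailLen n w), f y 1 + f (tailLen n w + 1) (tailLen n w⁻¹ + 1) := by
  have h1 := one_le_tailLen hn w
  have h2 := hd.tailLen_eq hw.supp hn
  obtain ⟨m, hm⟩ := Nat.exists_eq_add_of_le' h1
  rw [hm, Finset.sum_Icc_succ_top (by omega), sum_children_of_lt f hw hn (by omega) (by omega),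
    ← hm, tailLen_insMax hw h1 (tailLen_le n w) (decTail_tailLen n w),
    tailLen_insMax_inv' hw hn (by omega)]

lemma sum_children_of_not_decAfterMax (hw : IsInd n w) (hn : 1 ≤ n) (hd : ¬ DecAfterMax n w) :
    ∑ r ∈ Finset.Icc 1 (tailLen n w),
        f (tailLen (n + 1) (insMax n r w)) (tailLen (n + 1) (insMax n r w)⁻¹) =
      ∑ y ∈ Finset.Icc 2 (tailLen n w + 1), f y 1 := by
  refine sum_children_of_lt f hw hn le_rfl ?_
  by_contra hc
  refine hd fun i j hi hij hj => ?_
  exact decTail_tailLen n w i j (by omega) hij hj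

end Children

lemma tailLen_revPerm {n : ℕ} (hn : 1 ≤ n) : tailLen n (revPerm n) = n := by
  have := (decAfterMax_revPerm n hn).tailLen_eq (isInd_revPerm n).supp hn
  rw [revPerm_inv, revPerm_apply, if_pos (by omega)] at this
  omega

theorem treeRule_treeNodes :
    TreeRule treeNodes tailLen (fun n w => tailLen n w⁻¹) := by
  refine ⟨?_, fun n w hw => ?_, fun n hn f => ?_⟩
  · refine Finset.eq_empty_of_forall_notMem fun w hw => ?_
    obtain ⟨h1, h2, -⟩ := mem_treeNodes.1 hw
    refine h1 (h2.supp.eq_revPerm fun i j _ _ _ => ?_)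
    push_cast at *
    omega
  · obtain ⟨h1, h2, h3⟩ := mem_treeNodes.1 hw
    rcases Nat.eq_zero_or_pos n with rfl | hn
    · refine absurd (h2.supp.eq_revPerm fun i j _ _ _ => ?_) h1
      push_cast at *
      omega
    · exact one_le_tailLen hn w
  · rw [sum_treeNodes_succ hn fun u => f (tailLen (n + 1) u) (tailLen (n + 1) u⁻¹), sum_indSet,
      sum_children_of_decAfterMax f (isInd_revPerm n) hn (decAfterMax_revPerm n hn), revPerm_inv,
      revPerm_inv, tailLen_revPerm hn, tailLen_revPerm (by omega), add_sub_assoc, add_sub_cancel_right]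
    congr 1
    refine Finset.sum_congr rfl fun w hw => ?_
    obtain ⟨h1, h2, h3⟩ := mem_treeNodes.1 hw
    rw [sum_children_of_decAfterMax f h2 hn h3, sum_children_of_not_decAfterMax f h2.inv hn]
    exact fun h => h1 (h2.eq_revPerm h3 h)

/-- `w` preserves the set of integers at most `k`. -/
def IsCut (w : Equiv.Perm ℤ) (k : ℤ) : Prop := ∀ j, w j ≤ k ↔ j ≤ k

/-- Conjugation by the translation by `p`. -/
def shiftPerm (p : ℤ) (u : Equiv.Perm ℤ) : Equiv.Perm ℤ where
  toFun i := u (i - p) + p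
  invFun i := u⁻¹ (i - p) + p
  left_inv i := by simp
  right_inv i := by simp

lemma shiftPerm_apply (p : ℤ) (u : Equiv.Perm ℤ) (i : ℤ) : shiftPerm p u i = u (i - p) + p := rfl

lemma shiftPerm_shiftPerm (p q : ℤ) (u : Equiv.Perm ℤ) :
    shiftPerm p (shiftPerm q u) = shiftPerm (p + q) u := by
  ext i
  simp only [shiftPerm_apply, sub_sub]
  ring

lemma shiftPerm_zero (u : Equiv.Perm ℤ) : shiftPerm 0 u = u := by
  ext i; simp [shiftPerm_apply]

lemma isCut_shiftPerm {p k : ℤ} {u : Equiv.Perm ℤ} : IsCut (shiftPerm p u) k ↔ IsCut u (k - p) := by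
  constructor
  · intro h j
    have := h (j + p)
    rw [shiftPerm_apply, add_sub_cancel_right] at this
    omega
  · intro h j
    have := h (j - p)
    rw [shiftPerm_apply]
    omega

lemma SmoothPerm.shift {u : Equiv.Perm ℤ} (h : SmoothPerm u) (p : ℤ) : SmoothPerm (shiftPerm p u) :=
  h.transfer (fun _ => True) (fun i => i - p) (fun _ _ _ _ => ⟨trivial, trivial⟩)
    (fun i j _ _ h => by omega) (fun i j _ _ h => by simp only [shiftPerm_apply] at h; omega)

lemma exists_restrict (v : Equiv.Perm ℤ) (P : ℤ → Prop) (h : ∀ i, P (v i) ↔ P i) :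
    ∃ u : Equiv.Perm ℤ, (∀ i, P i → u i = v i) ∧ ∀ i, ¬ P i → u i = i := by
  classical
  exact ⟨Equiv.Perm.ofSubtype (v.subtypePerm h),
    fun i hi => by rw [Equiv.Perm.ofSubtype_apply_of_mem _ hi]; rfl,
    fun i hi => Equiv.Perm.ofSubtype_apply_of_not_mem _ hi⟩

/-- Smooth permutations of `{1, …, n}`. -/
noncomputable def smoothSet (n : ℕ) : Finset (Equiv.Perm ℤ) :=
  Set.Finite.toFinset (s := {w | SuppIn n w ∧ SmoothPerm w})
    ((finite_suppIn n).subset fun _ h => h.1)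

lemma mem_smoothSet {n : ℕ} {w : Equiv.Perm ℤ} : w ∈ smoothSet n ↔ SuppIn n w ∧ SmoothPerm w := by
  simp [smoothSet]

open Classical in
/-- Smooth permutations of `{1, …, n}` whose largest cut below `n` is `p`. -/
noncomputable def blockSet (n p : ℕ) : Finset (Equiv.Perm ℤ) :=
  (smoothSet n).filter fun w => IsCut w p ∧ ∀ k : ℤ, p < k → k < n → ¬ IsCut w k

lemma mem_blockSet {n p : ℕ} {w : Equiv.Perm ℤ} : w ∈ blockSet n p ↔
    (SuppIn n w ∧ SmoothPerm w) ∧ IsCut w p ∧ ∀ k : ℤ, p < k → k < n → ¬ IsCut w k := by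
  classical
  rw [blockSet, Finset.mem_filter, mem_smoothSet]

section DirectSum

variable {p k : ℕ} {v u : Equiv.Perm ℤ} {i : ℤ}

lemma dirSum_le (hu : SuppIn k u) (hi : i ≤ p) : (v * shiftPerm p u) i = v i := by
  rw [Equiv.Perm.mul_apply, shiftPerm_apply, hu _ (by omega), sub_add_cancel]

lemma dirSum_gt (hv : SuppIn p v) (hu : SuppIn k u) (hi : p < i) :
    (v * shiftPerm p u) i = u (i - p) + p ∧ p < u (i - p) + p := by
  have : 1 ≤ u (i - p) := by
    by_cases h : i - p ≤ k
    · exact (hu.bounds (by omega) h).1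
    · rw [hu _ (by omega)]; omega
  rw [Equiv.Perm.mul_apply, shiftPerm_apply, hv _ (by omega)]
  exact ⟨rfl, by omega⟩

lemma dirSum_mem (hv : v ∈ smoothSet p) (hu : u ∈ indSet k) :
    v * shiftPerm p u ∈ blockSet (p + k) p := by
  rw [mem_smoothSet] at hv
  rw [mem_indSet] at hu
  have hgt := fun i (hi : (p : ℤ) < i) => dirSum_gt (i := i) hv.1 hu.supp hi
  have hle := fun i (hi : i ≤ (p : ℤ)) => dirSum_le (i := i) (v := v) hu.supp hi
  have hvp := fun i (hi : i ≤ (p : ℤ)) => hv.1.le_of_le (i := i) hi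
  refine mem_blockSet.2 ⟨⟨fun i hi => ?_, ?_⟩, fun j => ?_, fun l h1 h2 hc => ?_⟩
  · push_cast at hi
    by_cases h : i ≤ p
    · rw [hle i h, hv.1 i (by omega)]
    · rw [(hgt i (by omega)).1, hu.supp _ (by omega)]; omega
  · intro a b c d hab hbc hcd
    by_cases hd : d ≤ p
    · rw [hle a (by omega), hle b (by omega), hle c (by omega), hle d (by omega)]
      exact hv.2 a b c d hab hbc hcd
    by_cases ha : p < a
    · rw [(hgt a (by omega)).1, (hgt b (by omega)).1, (hgt c (by omega)).1, (hgt d (by omega)).1]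
      have := hu.smooth (a - p) (b - p) (c - p) (d - p) (by omega) (by omega) (by omega)
      omega
    have h1 := hgt d (by omega)
    have h2 := hle a (by omega)
    have h3 := hvp a (by omega)
    omega
  · by_cases h : j ≤ p
    · rw [hle j h]
      exact iff_of_true (hvp j h) h
    · have := hgt j (by omega)
      omega
  · obtain ⟨j, hj1, hj2⟩ := hu.noCut (l - p) (by omega) (by push_cast at h2; omega)
    have := (hc (j + p)).2 (by omega)
    have h1 : 1 ≤ j := by
      by_contra hcon
      rw [hu.supp j (by omega)] at hj2
      omega
    rw [(hgt (j + p) (by omega)).1, add_sub_cancel_right] at this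
    omega

lemma exists_dirSum {w : Equiv.Perm ℤ} (hw : w ∈ blockSet (p + k) p) :
    ∃ v ∈ smoothSet p, ∃ u ∈ indSet k, v * shiftPerm p u = w := by
  obtain ⟨⟨hs, hsm⟩, hc, hnc⟩ := mem_blockSet.1 hw
  obtain ⟨v, hv1, hv2⟩ := exists_restrict w (fun i => i ≤ p) hc
  have hc' : ∀ i, 1 ≤ shiftPerm (-p) w i ↔ 1 ≤ i := by
    intro i
    have := hc (i + p)
    rw [shiftPerm_apply, sub_neg_eq_add]
    omega
  obtain ⟨u, hu1, hu2⟩ := exists_restrict (shiftPerm (-p) w) (fun i => 1 ≤ i) hc'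
  simp only [shiftPerm_apply, sub_neg_eq_add] at hu1
  have hvs : SuppIn p v := by
    intro i hi
    by_cases h : i ≤ p
    · rw [hv1 i h, hs i (by omega)]
    · exact hv2 i h
  have hus : SuppIn k u := by
    intro i hi
    by_cases h : 1 ≤ i
    · rw [hu1 i h, hs _ (by push_cast; omega)]; omega
    · exact hu2 i h
  refine ⟨v, mem_smoothSet.2 ⟨hvs, ?_⟩, u, mem_indSet.2 ⟨hus, ?_, fun l h1 h2 => ?_⟩, ?_⟩
  · refine hsm.transfer (fun i => i ≤ p) id (fun i j hij hw => ?_) (fun _ _ _ _ h => h) ?_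
    · have := hvs.inversion hij hw
      exact ⟨this.1.2, this.2.2⟩
    · intro i j hi hj h
      rwa [hv1 i hi, hv1 j hj] at h
  · refine hsm.transfer (fun i => 1 ≤ i) (fun i => i + p) (fun i j hij hw => ?_)
      (fun _ _ _ _ h => by omega) ?_
    · have := hus.inversion hij hw
      exact ⟨this.1.1, this.2.1⟩
    · intro i j hi hj h
      rw [hu1 i hi, hu1 j hj] at h
      omega
  · by_contra! hcon
    refine hnc (l + p) (by omega) (by push_cast; omega) fun j => ?_
    have h3 := hus.preserves hcon (j - p)
    by_cases hj : p < j
    · rw [hu1 _ (by omega), sub_add_cancel] at h3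
      omega
    · have := (hc j).2 (by omega)
      omega
  · ext i
    by_cases h : i ≤ p
    · rw [dirSum_le hus h, hv1 i h]
    · rw [(dirSum_gt hvs hus (by omega)).1, hu1 _ (by omega), sub_add_cancel]; omega

lemma dirSum_inj {v' u' : Equiv.Perm ℤ} (hv : SuppIn p v) (hu : SuppIn k u) (hv' : SuppIn p v')
    (hu' : SuppIn k u') (h : v * shiftPerm p u = v' * shiftPerm p u') : v = v' ∧ u = u' := by
  constructor
  · ext i
    by_cases hi : i ≤ p
    · rw [← dirSum_le (v := v) hu hi, h, dirSum_le hu' hi]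
    · rw [hv i (by omega), hv' i (by omega)]
  · ext i
    by_cases hi : 1 ≤ i
    · have h1 := dirSum_gt (i := i + p) hv hu (by omega)
      have h2 := dirSum_gt (i := i + p) hv' hu' (by omega)
      rw [h] at h1
      rw [add_sub_cancel_right] at h1 h2
      omega
    · rw [hu i (by omega), hu' i (by omega)]

lemma card_blockSet (p k : ℕ) :
    (blockSet (p + k) p).card = (smoothSet p).card * (indSet k).card := by
  rw [← Finset.card_product]
  symm
  refine Finset.card_bij (fun x _ => x.1 * shiftPerm p x.2) ?_ ?_ ?_
  · rintro ⟨v, u⟩ h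
    rw [Finset.mem_product] at h
    exact dirSum_mem h.1 h.2
  · rintro ⟨v, u⟩ h ⟨v', u'⟩ h' e
    rw [Finset.mem_product, mem_smoothSet, mem_indSet] at h h'
    obtain ⟨rfl, rfl⟩ := dirSum_inj h.1.1 h.2.supp h'.1.1 h'.2.supp e
    rfl
  · intro w hw
    obtain ⟨v, hv, u, hu, e⟩ := exists_dirSum hw
    exact ⟨(v, u), Finset.mem_product.2 ⟨hv, hu⟩, e⟩

end DirectSum

lemma SuppIn.isCut_zero {n : ℕ} {w : Equiv.Perm ℤ} (h : SuppIn n w) : IsCut w 0 := by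
  refine h.preserves fun j hj => ?_
  rw [h j (by omega)]; exact hj

lemma exists_mem_blockSet {n : ℕ} (hn : 1 ≤ n) {w : Equiv.Perm ℤ} (hw : w ∈ smoothSet n) :
    ∃ p < n, w ∈ blockSet n p := by
  classical
  rw [mem_smoothSet] at hw
  set p := Nat.findGreatest (fun p : ℕ => IsCut w p) (n - 1) with hp
  have h1 : IsCut w p := Nat.findGreatest_spec (P := fun p : ℕ => IsCut w p) (m := 0)
    (Nat.zero_le _) (by simpa using hw.1.isCut_zero)
  have h2 : p ≤ n - 1 := Nat.findGreatest_le _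
  refine ⟨p, by omega, mem_blockSet.2 ⟨hw, h1, fun k hk hkn hc => ?_⟩⟩
  obtain ⟨q, rfl⟩ : ∃ q : ℕ, k = q := ⟨k.toNat, by omega⟩
  have := Nat.le_findGreatest (P := fun p : ℕ => IsCut w p) (n := n - 1) (by omega) hc
  omega

lemma blockSet_unique {n p q : ℕ} {w : Equiv.Perm ℤ} (hp : p < n) (hq : q < n)
    (h1 : w ∈ blockSet n p) (h2 : w ∈ blockSet n q) : p = q := by
  obtain ⟨-, c1, n1⟩ := mem_blockSet.1 h1
  obtain ⟨-, c2, n2⟩ := mem_blockSet.1 h2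
  rcases lt_trichotomy p q with h | h | h
  · exact absurd c2 (n1 q (by omega) (by omega))
  · exact h
  · exact absurd c1 (n2 p (by omega) (by omega))

lemma card_smoothSet_succ (n : ℕ) : (smoothSet (n + 1)).card =
    ∑ k ∈ Finset.range (n + 1), (indSet (k + 1)).card * (smoothSet (n - k)).card := by
  classical
  have e : smoothSet (n + 1) = (Finset.range (n + 1)).biUnion (blockSet (n + 1)) := by
    ext w
    rw [Finset.mem_biUnion]
    constructor
    · intro h
      obtain ⟨p, hp, hw⟩ := exists_mem_blockSet (by omega) h
      exact ⟨p, Finset.mem_range.2 hp, hw⟩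
    · rintro ⟨p, -, hw⟩
      exact mem_smoothSet.2 (mem_blockSet.1 hw).1
  rw [e, Finset.card_biUnion, ← Finset.sum_range_reflect]
  · refine Finset.sum_congr rfl fun k hk => ?_
    rw [Finset.mem_range] at hk
    have := card_blockSet (n - k) (k + 1)
    rw [show n - k + (k + 1) = n + 1 by omega] at this
    rw [show n + 1 - 1 - k = n - k by omega, this, mul_comm]
  · intro p hp q hq hpq
    refine Finset.disjoint_left.2 fun w h1 h2 => hpq ?_
    exact blockSet_unique (Finset.mem_range.1 hp) (Finset.mem_range.1 hq) h1 h2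

lemma card_smoothSet_zero : (smoothSet 0).card = 1 := by
  rw [Finset.card_eq_one]
  refine ⟨1, ?_⟩
  ext w
  rw [mem_smoothSet, Finset.mem_singleton]
  constructor
  · rintro ⟨h, -⟩
    ext i
    exact h i (by push_cast; omega)
  · rintro rfl
    exact ⟨fun i _ => rfl, fun a b c d h1 h2 h3 => by simp only [Equiv.Perm.one_apply]; omega⟩

section Affine

variable {n : ℕ} {w : Equiv.Perm ℤ}

lemma sum_window_succ {g : ℤ → ℤ} (hg : ∀ i, g (i + n) = g i) (a : ℤ) :
    ∑ i ∈ Finset.Ico (a + 1) (a + 1 + n), g i = ∑ i ∈ Finset.Ico a (a + n), g i := by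
  rcases Nat.eq_zero_or_pos n with rfl | hn
  · simp
  have e : insert (a + n) (Finset.Ico a (a + n)) = insert a (Finset.Ico (a + 1) (a + 1 + n)) := by
    ext x
    simp only [Finset.mem_insert, Finset.mem_Ico]
    omega
  have := congrArg (fun s => ∑ i ∈ s, g i) e
  rw [Finset.sum_insert (by simp), Finset.sum_insert (by simp), hg] at this
  omega

lemma sum_window {g : ℤ → ℤ} (hg : ∀ i, g (i + n) = g i) (a b : ℤ) :
    ∑ i ∈ Finset.Ico a (a + n), g i = ∑ i ∈ Finset.Ico b (b + n), g i := by
  have key : ∀ a : ℤ, ∑ i ∈ Finset.Ico a (a + n), g i = ∑ i ∈ Finset.Ico 0 ((0 : ℤ) + n), g i := by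
    intro a
    induction a using Int.induction_on with
    | zero => rfl
    | succ i ih => rw [sum_window_succ hg, ih]
    | pred i ih =>
      have := sum_window_succ hg (-(i : ℤ) - 1)
      rw [sub_add_cancel] at this
      rw [← this, ih]
  rw [key a, key b]

lemma isAffinePerm_iff (a : ℤ) : IsAffinePerm n w ↔
    (∀ i : ℤ, w (i + n) = w i + n) ∧ ∑ i ∈ Finset.Ico a (a + n), (w i - i) = 0 := by
  refine and_congr_right fun hp => ?_
  rw [sum_window (g := fun i => w i - i) (n := n) (fun i => by rw [hp]; ring) a 1,
    show Finset.Ico (1 : ℤ) (1 + n) = Finset.Icc 1 (n : ℤ) by ext; simp; omega,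
    Finset.sum_sub_distrib, sub_eq_zero]

lemma IsAffinePerm.shift (h : IsAffinePerm n w) (p : ℤ) : IsAffinePerm n (shiftPerm p w) := by
  refine (isAffinePerm_iff p).2 ⟨fun i => ?_, ?_⟩
  · rw [shiftPerm_apply, shiftPerm_apply, show i + n - p = i - p + n by ring, h.1]; ring
  · rw [← ((isAffinePerm_iff 0).1 h).2]
    refine Finset.sum_bij (fun i _ => i - p) ?_ ?_ ?_ ?_
    · intro i hi
      rw [Finset.mem_Ico] at hi ⊢
      omega
    · intro i _ j _ hij
      omega
    · intro j hj
      rw [Finset.mem_Ico] at hj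
      exact ⟨j + p, by rw [Finset.mem_Ico]; omega, by ring⟩
    · intro i _
      rw [shiftPerm_apply]; ring

lemma IsAffinePerm.apply_add_mul (h : IsAffinePerm n w) (i q : ℤ) : w (i + n * q) = w i + n * q := by
  induction q using Int.induction_on with
  | zero => simp
  | succ q ih => rw [mul_add, mul_one, ← add_assoc, h.1, ih]; ring
  | pred q ih =>
    have := h.1 (i + n * (-q - 1))
    rw [show i + n * (-(q : ℤ) - 1) + n = i + n * (-q) by ring, ih] at this
    linarith

lemma IsAffinePerm.isCut_add_mul (h : IsAffinePerm n w) {k : ℤ} (q : ℤ) (hk : IsCut w k) :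
    IsCut w (k + n * q) := by
  intro j
  have h1 := hk (j - n * q)
  have h2 := h.apply_add_mul (j - n * q) q
  rw [sub_add_cancel] at h2
  rw [h2]
  omega

/-- The index of the window containing `i`. -/
def windowIdx (n : ℕ) (i : ℤ) : ℤ := (i - 1) / n

lemma windowIdx_eq (hn : 0 < n) {i q : ℤ} (h1 : 1 ≤ i - n * q) (h2 : i - n * q ≤ n) :
    windowIdx n i = q := by
  rw [windowIdx, show i - 1 = (i - n * q - 1) + n * q by ring,
    Int.add_mul_ediv_left _ _ (by omega), Int.ediv_eq_zero_of_lt (by omega) (by omega), zero_add]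

lemma windowIdx_spec (hn : 0 < n) (i : ℤ) :
    1 ≤ i - n * windowIdx n i ∧ i - n * windowIdx n i ≤ n := by
  have h1 := Int.mul_ediv_add_emod (i - 1) n
  have h2 := Int.emod_nonneg (i - 1) (b := n) (by omega)
  have h3 := Int.emod_lt_of_pos (i - 1) (b := n) (by omega)
  rw [windowIdx]
  constructor <;> linarith

lemma windowIdx_mono (hn : 0 < n) {i j : ℤ} (h : i ≤ j) : windowIdx n i ≤ windowIdx n j :=
  Int.ediv_le_ediv (by omega) (by omega)

/-- The periodic extension of a permutation of `{1, …, n}`. -/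
def periodicExt (hn : 0 < n) (u : Equiv.Perm ℤ) (hu : SuppIn n u) : Equiv.Perm ℤ where
  toFun i := u (i - n * windowIdx n i) + n * windowIdx n i
  invFun i := u⁻¹ (i - n * windowIdx n i) + n * windowIdx n i
  left_inv i := by
    have h1 := windowIdx_spec hn i
    have h2 := hu.bounds h1.1 h1.2
    have h3 : windowIdx n (u (i - n * windowIdx n i) + n * windowIdx n i) = windowIdx n i :=
      windowIdx_eq hn (by rw [add_sub_cancel_right]; exact h2.1)
        (by rw [add_sub_cancel_right]; exact h2.2)
    simp only [h3, add_sub_cancel_right, perm_inv_apply, sub_add_cancel]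
  right_inv i := by
    have h1 := windowIdx_spec hn i
    have h2 := hu.inv.bounds h1.1 h1.2
    have h3 : windowIdx n (u⁻¹ (i - n * windowIdx n i) + n * windowIdx n i) = windowIdx n i :=
      windowIdx_eq hn (by rw [add_sub_cancel_right]; exact h2.1)
        (by rw [add_sub_cancel_right]; exact h2.2)
    simp only [h3, add_sub_cancel_right, perm_apply_inv, sub_add_cancel]

variable {u : Equiv.Perm ℤ} {hn : 0 < n} {hu : SuppIn n u}

lemma periodicExt_apply (i : ℤ) : periodicExt hn u hu i =
    u (i - n * windowIdx n i) + n * windowIdx n i := rfl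

lemma periodicExt_of_mem {i : ℤ} (h1 : 1 ≤ i) (h2 : i ≤ n) : periodicExt hn u hu i = u i := by
  rw [periodicExt_apply, windowIdx_eq (q := 0) hn (by simpa using h1) (by simpa using h2)]
  simp

lemma isAffinePerm_periodicExt : IsAffinePerm n (periodicExt hn u hu) := by
  refine ⟨fun i => ?_, ?_⟩
  · have h := windowIdx_spec hn i
    have : windowIdx n (i + n) = windowIdx n i + 1 :=
      windowIdx_eq hn (by linarith) (by linarith)
    rw [periodicExt_apply, periodicExt_apply, this,
      show i + n - n * (windowIdx n i + 1) = i - n * windowIdx n i by ring]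
    ring
  · rw [Finset.sum_congr rfl fun i hi =>
      periodicExt_of_mem (Finset.mem_Icc.1 hi).1 (Finset.mem_Icc.1 hi).2]
    refine Finset.sum_bij (fun i _ => u i) (fun i hi => ?_) (fun _ _ _ _ h => u.injective h)
      (fun j hj => ⟨u⁻¹ j, ?_, perm_apply_inv u j⟩) fun _ _ => rfl
    · rw [Finset.mem_Icc] at hi ⊢
      exact hu.bounds hi.1 hi.2
    · rw [Finset.mem_Icc] at hj ⊢
      exact hu.inv.bounds hj.1 hj.2

lemma periodicExt_windowIdx (i : ℤ) : windowIdx n (periodicExt hn u hu i) = windowIdx n i := by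
  have h1 := windowIdx_spec hn i
  have h2 := hu.bounds h1.1 h1.2
  exact windowIdx_eq hn (by rw [periodicExt_apply, add_sub_cancel_right]; exact h2.1)
    (by rw [periodicExt_apply, add_sub_cancel_right]; exact h2.2)

lemma smoothPerm_periodicExt (hs : SmoothPerm u) : SmoothPerm (periodicExt hn u hu) := by
  intro a b c d hab hbc hcd
  by_cases hda : periodicExt hn u hu d < periodicExt hn u hu a
  swap
  · constructor <;> rintro ⟨h1, h2, h3⟩ <;> omega
  have h1 := windowIdx_mono hn hda.le
  rw [periodicExt_windowIdx, periodicExt_windowIdx] at h1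
  have h2 := windowIdx_mono hn hab.le
  have h3 := windowIdx_mono hn hbc.le
  have h4 := windowIdx_mono hn hcd.le
  have eb : windowIdx n b = windowIdx n a := by omega
  have ec : windowIdx n c = windowIdx n a := by omega
  have ed : windowIdx n d = windowIdx n a := by omega
  simp only [periodicExt_apply, eb, ec, ed, add_lt_add_iff_right]
  exact hs _ _ _ _ (by omega) (by omega) (by omega)

lemma isCut_periodicExt {k : ℤ} (h1 : 0 ≤ k) (h2 : k ≤ n) (hc : IsCut u k) :
    IsCut (periodicExt hn u hu) k := by
  have key : ∀ j, windowIdx n j = 0 ∧ (1 ≤ j ∧ j ≤ n) ∨ windowIdx n j < 0 ∧ j < 1 ∨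
      0 < windowIdx n j ∧ n < j := by
    intro j
    have h := windowIdx_spec hn j
    rcases lt_trichotomy (windowIdx n j) 0 with h0 | h0 | h0
    · have : (n : ℤ) * windowIdx n j ≤ n * (-1) :=
        mul_le_mul_of_nonneg_left (by omega) (by omega)
      right; left; constructor <;> linarith
    · left
      rw [h0, mul_zero, sub_zero] at h
      exact ⟨h0, h⟩
    · have : (n : ℤ) * 1 ≤ n * windowIdx n j :=
        mul_le_mul_of_nonneg_left (by omega) (by omega)
      right; right; constructor <;> linarith
  intro j
  have e := periodicExt_windowIdx (hn := hn) (hu := hu) j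
  have k1 := key j
  have k2 := key (periodicExt hn u hu j)
  rw [e] at k2
  by_cases hj : 1 ≤ j ∧ j ≤ n
  · rw [periodicExt_of_mem hj.1 hj.2]
    exact hc j
  · omega

lemma isCut_of_isCut_periodicExt {k : ℤ} (hc : IsCut (periodicExt hn u hu) k) : IsCut u k := by
  intro j
  by_cases hj : 1 ≤ j ∧ j ≤ n
  · rw [← periodicExt_of_mem (hn := hn) (hu := hu) hj.1 hj.2]
    exact hc j
  · rw [hu j (by omega)]

lemma periodicExt_inj {u' : Equiv.Perm ℤ} {hu' : SuppIn n u'}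
    (h : periodicExt hn u hu = periodicExt hn u' hu') : u = u' := by
  ext i
  by_cases hi : 1 ≤ i ∧ i ≤ n
  · rw [← periodicExt_of_mem (hn := hn) (hu := hu) hi.1 hi.2, h, periodicExt_of_mem hi.1 hi.2]
  · rw [hu i (by omega), hu' i (by omega)]

/-- An affine permutation with a cut at `0` is a periodic extension. -/
lemma IsAffinePerm.exists_periodicExt (h : IsAffinePerm n w) (hn : 0 < n) (hs : SmoothPerm w)
    (hc : IsCut w 0) : ∃ (u : Equiv.Perm ℤ) (hu : SuppIn n u), SmoothPerm u ∧
      periodicExt hn u hu = w := by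
  have hc' := h.isCut_add_mul 1 hc
  rw [mul_one, zero_add] at hc'
  obtain ⟨u, hu1, hu2⟩ := exists_restrict w (fun i => 1 ≤ i ∧ i ≤ n) fun i => by
    have := hc i
    have := hc' i
    omega
  have hu : SuppIn n u := fun i hi => hu2 i (by omega)
  refine ⟨u, hu, ?_, ?_⟩
  · refine hs.transfer (fun i => 1 ≤ i ∧ i ≤ n) id (fun i j hij hw => hu.inversion hij hw)
      (fun _ _ _ _ h => h) fun i j hi hj hij => ?_
    rwa [hu1 i hi, hu1 j hj] at hij
  · ext i
    rw [periodicExt_apply, hu1 _ (windowIdx_spec hn i), ← h.apply_add_mul, sub_add_cancel]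

end Affine

/-- The smooth affine permutations with a cut. -/
def cutAffine (n : ℕ) : Set (Equiv.Perm ℤ) :=
  {w | (IsAffinePerm n w ∧ SmoothPerm w) ∧ ∃ k, IsCut w k}

lemma ncard_cutAffine_aux {n : ℕ} (hn : 0 < n) :
    ((Finset.range n).sigma fun p => blockSet n p ×ˢ Finset.range (n - p) :
      Finset (Σ _ : ℕ, Equiv.Perm ℤ × ℕ)).card = (cutAffine n).ncard ∧ (cutAffine n).Finite := by
  set T : Finset (Σ _ : ℕ, Equiv.Perm ℤ × ℕ) :=
    (Finset.range n).sigma fun p => blockSet n p ×ˢ Finset.range (n - p) with hT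
  have hmem : ∀ x, x ∈ T ↔ x.1 < n ∧ x.2.1 ∈ blockSet n x.1 ∧ x.2.2 < n - x.1 := by
    intro x
    simp [hT]
  have hsupp : ∀ x ∈ T, SuppIn n x.2.1 := fun x hx => (mem_blockSet.1 ((hmem x).1 hx).2.1).1.1
  let F : ∀ x ∈ T, Equiv.Perm ℤ := fun x hx => shiftPerm x.2.2 (periodicExt hn x.2.1 (hsupp x hx))
  have hF1 : ∀ x hx, F x hx ∈ cutAffine n := by
    intro x hx
    obtain ⟨⟨h1, h2⟩, -⟩ := mem_blockSet.1 ((hmem x).1 hx).2.1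
    refine ⟨⟨isAffinePerm_periodicExt.shift _, (smoothPerm_periodicExt h2).shift _⟩, x.2.2, ?_⟩
    rw [isCut_shiftPerm, sub_self]
    exact isCut_periodicExt le_rfl (by omega) h1.isCut_zero
  have hF2 : ∀ x y hx hy, F x hx = F y hy → x = y := by
    have hcut : ∀ x hx, IsCut (F x hx) x.2.2 ∧ ∀ j : ℤ, 0 ≤ j → j < x.2.2 → ¬ IsCut (F x hx) j := by
      intro x hx
      have hx' := (hmem x).1 hx
      obtain ⟨⟨h1, h2⟩, -, h3⟩ := mem_blockSet.1 hx'.2.1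
      refine ⟨?_, fun j hj0 hj hc => ?_⟩
      · rw [isCut_shiftPerm, sub_self]
        exact isCut_periodicExt le_rfl (by omega) h1.isCut_zero
      · have hc2 := (hF1 x hx).1.1.isCut_add_mul 1 hc
        rw [isCut_shiftPerm, mul_one] at hc2
        exact h3 _ (by omega) (by omega) (isCut_of_isCut_periodicExt hc2)
    rintro ⟨p, u, m⟩ ⟨q, v, l⟩ hx hy e
    have c1 := hcut _ hx
    have c2 := hcut _ hy
    rw [e] at c1
    have hml : m = l := by
      rcases lt_trichotomy m l with h | h | h
      · exact absurd c1.1 (c2.2 m (by omega) (by exact_mod_cast h))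
      · exact h
      · exact absurd c2.1 (c1.2 l (by omega) (by exact_mod_cast h))
    subst hml
    have e2 := congrArg (shiftPerm (-m)) e
    simp only [F, shiftPerm_shiftPerm, neg_add_cancel, shiftPerm_zero] at e2
    obtain rfl := periodicExt_inj e2
    have hx' := (hmem _).1 hx
    have hy' := (hmem _).1 hy
    obtain rfl := blockSet_unique hx'.1 hy'.1 hx'.2.1 hy'.2.1
    rfl
  have hF3 : ∀ w ∈ cutAffine n, ∃ x hx, F x hx = w := by
    classical
    rintro w ⟨⟨haff, hsm⟩, k, hk⟩
    have hex : ∃ m : ℕ, IsCut w m := by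
      refine ⟨(k + n * |k|).toNat, ?_⟩
      have h0 : 0 ≤ k + n * |k| := by
        have := neg_abs_le k
        have : 1 * |k| ≤ n * |k| := mul_le_mul_of_nonneg_right (by omega) (abs_nonneg k)
        omega
      rw [Int.toNat_of_nonneg h0]
      exact haff.isCut_add_mul _ hk
    set m := Nat.find hex with hm
    have hm1 : IsCut w m := Nat.find_spec hex
    have hm2 : ∀ j : ℤ, 0 ≤ j → j < m → ¬ IsCut w j := by
      intro j h1 h2 hc
      obtain ⟨j, rfl⟩ := Int.eq_ofNat_of_zero_le h1
      exact Nat.find_min hex (by exact_mod_cast h2) hc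
    have hc0 : IsCut (shiftPerm (-m) w) 0 := by
      rw [isCut_shiftPerm, zero_sub, neg_neg]; exact hm1
    obtain ⟨u, hu, hus, he⟩ := (haff.shift (-m)).exists_periodicExt hn (hsm.shift _) hc0
    obtain ⟨p, hp, hup⟩ := exists_mem_blockSet hn (mem_smoothSet.2 ⟨hu, hus⟩)
    have hFw : shiftPerm m (periodicExt hn u hu) = w := by
      rw [he, shiftPerm_shiftPerm, add_neg_cancel, shiftPerm_zero]
    have hpm : m < n - p := by
      by_contra hcon
      obtain ⟨-, hcp, -⟩ := mem_blockSet.1 hup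
      have h1 := isCut_periodicExt (hn := hn) (hu := hu) (by omega) (by omega) hcp
      rw [he, isCut_shiftPerm] at h1
      have h2 := haff.isCut_add_mul (-1) h1
      exact hm2 _ (by omega) (by omega) h2
    exact ⟨⟨p, u, m⟩, (hmem _).2 ⟨hp, hup, hpm⟩, hFw⟩
  let G : T → Equiv.Perm ℤ := fun x => F x.1 x.2
  have hG : Function.Injective G := fun x y h => Subtype.ext (hF2 _ _ x.2 y.2 h)
  have himg : cutAffine n = G '' Set.univ := by
    ext w
    constructor
    · intro hw
      obtain ⟨x, hx, e⟩ := hF3 w hw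
      exact ⟨⟨x, hx⟩, trivial, e⟩
    · rintro ⟨x, -, rfl⟩
      exact hF1 x.1 x.2
  refine ⟨?_, himg ▸ Set.finite_univ.image _⟩
  rw [himg, Set.ncard_image_of_injective _ hG, Set.ncard_univ]
  simp

lemma ncard_cutAffine {n : ℕ} (hn : 0 < n) : (cutAffine n).ncard =
    ∑ k ∈ Finset.range (n + 1), k * (indSet k).card * (smoothSet (n - k)).card := by
  rw [← (ncard_cutAffine_aux hn).1, Finset.card_sigma, Finset.sum_range_succ', zero_mul, zero_mul,
    add_zero, ← Finset.sum_range_reflect]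
  refine Finset.sum_congr rfl fun k hk => ?_
  rw [Finset.mem_range] at hk
  have := card_blockSet (n - (k + 1)) (k + 1)
  rw [show n - (k + 1) + (k + 1) = n by omega] at this
  rw [Finset.card_product, Finset.card_range, show n - 1 - k = n - (k + 1) by omega, this,
    show n - (n - (k + 1)) = k + 1 by omega]
  ring

/-- `b` is the largest value of `w` at the positions up to `k`. -/
def IsTopValue (w : Equiv.Perm ℤ) (k b : ℤ) : Prop := w⁻¹ b ≤ k ∧ ∀ x, w⁻¹ x ≤ k → x ≤ b

/-- `a` is the smallest value of `w` at the positions after `k`. -/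
def IsGapValue (w : Equiv.Perm ℤ) (k a : ℤ) : Prop := k < w⁻¹ a ∧ ∀ x, k < w⁻¹ x → a ≤ x

/-- A position `k` minimizing the excess of the largest earlier value, with ties resolved by
the smallest later value. -/
structure IsExtremal (w : Equiv.Perm ℤ) (k a b : ℤ) : Prop where
  top : IsTopValue w k b
  gap : IsGapValue w k a
  min : ∀ k' b', IsTopValue w k' b' → b - k ≤ b' - k'
  tie : ∀ k' b' a', IsTopValue w k' b' → IsGapValue w k' a' → b' - k' = b - k → k - a ≤ k' - a'

section Extremal

variable {n : ℕ} {w : Equiv.Perm ℤ}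

lemma IsAffinePerm.exists_bound (h : IsAffinePerm n w) (hn : 0 < n) : ∃ M, ∀ j, |w j - j| ≤ M := by
  refine ⟨∑ i ∈ Finset.Icc (1 : ℤ) n, |w i - i|, fun j => ?_⟩
  have h1 := windowIdx_spec hn j
  have h2 := h.apply_add_mul (j - n * windowIdx n j) (windowIdx n j)
  rw [sub_add_cancel] at h2
  rw [show w j - j = w (j - n * windowIdx n j) - (j - n * windowIdx n j) by rw [h2]; ring]
  exact Finset.single_le_sum (f := fun i => |w i - i|) (fun i _ => abs_nonneg _)
    (Finset.mem_Icc.2 h1)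

lemma exists_isTop {M : ℤ} (hM : ∀ j, |w j - j| ≤ M) (k : ℤ) : ∃ b, IsTopValue w k b := by
  refine Int.exists_greatest_of_bdd (P := fun x => w⁻¹ x ≤ k) ⟨k + M, fun x hx => ?_⟩
    ⟨w k, by rw [perm_inv_apply]⟩
  have := abs_le.1 (hM (w⁻¹ x))
  rw [perm_apply_inv] at this
  omega

lemma exists_isGap {M : ℤ} (hM : ∀ j, |w j - j| ≤ M) (k : ℤ) : ∃ a, IsGapValue w k a := by
  refine Int.exists_least_of_bdd (P := fun x => k < w⁻¹ x) ⟨k - M, fun x hx => ?_⟩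
    ⟨w (k + 1), by rw [perm_inv_apply]; omega⟩
  have := abs_le.1 (hM (w⁻¹ x))
  rw [perm_apply_inv] at this
  omega

lemma exists_isExtremal {M : ℤ} (hM : ∀ j, |w j - j| ≤ M) : ∃ k a b, IsExtremal w k a b := by
  obtain ⟨d, ⟨k₀, b₀, h0, hd⟩, hmin⟩ := Int.exists_least_of_bdd
    (P := fun d => ∃ k b, IsTopValue w k b ∧ d = b - k)
    ⟨-M, by
      rintro d ⟨k, b, hb, rfl⟩
      have := hb.2 (w k) (by rw [perm_inv_apply])
      have := abs_le.1 (hM k)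
      omega⟩
    (by obtain ⟨b, hb⟩ := exists_isTop hM 0; exact ⟨_, 0, b, hb, rfl⟩)
  obtain ⟨m, ⟨k, b, a, h1, h2, h3, hm⟩, htie⟩ := Int.exists_least_of_bdd
    (P := fun m => ∃ k b a, IsTopValue w k b ∧ IsGapValue w k a ∧ b - k = d ∧ m = k - a)
    ⟨-1 - M, by
      rintro m ⟨k, b, a, hb, ha, -, rfl⟩
      have := ha.2 (w (k + 1)) (by rw [perm_inv_apply]; omega)
      have := abs_le.1 (hM (k + 1))
      omega⟩
    (by obtain ⟨a, ha⟩ := exists_isGap hM k₀; exact ⟨_, k₀, b₀, a, h0, ha, hd.symm, rfl⟩)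
  refine ⟨k, a, b, h1, h2, fun k' b' h => ?_, fun k' b' a' h h' he => ?_⟩
  · rw [h3]; exact hmin _ ⟨k', b', h, rfl⟩
  · rw [← hm]; exact htie _ ⟨k', b', a', h, h', by omega, rfl⟩

variable {k a b : ℤ}

lemma IsExtremal.lt_succ (h : IsExtremal w k a b) : b < w (k + 1) := by
  by_contra hc
  have : IsTopValue w (k + 1) b := by
    refine ⟨by have := h.top.1; omega, fun x hx => ?_⟩
    rcases hx.lt_or_eq with hx | hx
    · exact h.top.2 x (by omega)
    · rw [← hx, perm_apply_inv] at hc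
      omega
  have := h.min _ _ this
  omega

lemma IsExtremal.isUpper (h : IsExtremal w k a b) (hs : SmoothPerm w) {M : ℤ}
    (hM : ∀ j, |w j - j| ≤ M) {q r : ℤ} (haq : a < q) (hqr : q < r) (hrb : r < b)
    (hq : w⁻¹ q ≤ k) : w⁻¹ r ≤ k := by
  by_contra! hr
  have hk1 := h.lt_succ
  have hA := h.gap.1
  have hB := h.top.1
  have hne : w⁻¹ a ≠ k + 1 := by
    intro e
    rw [← e, perm_apply_inv] at hk1
    omega
  rcases lt_trichotomy (w⁻¹ a) (w⁻¹ r) with har | har | har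
  · refine (hs (w⁻¹ b) (k + 1) (w⁻¹ a) (w⁻¹ r) (by omega) (by omega) har).1 ?_
    simp only [perm_apply_inv]
    omega
  · have := w⁻¹.injective har
    omega
  obtain ⟨e, he, hemin⟩ := Int.exists_least_of_bdd (P := fun j => r < w j)
    ⟨r - M, fun j hj => by have := abs_le.1 (hM j); omega⟩ ⟨w⁻¹ b, by rwa [perm_apply_inv]⟩
  have heB := hemin (w⁻¹ b) (by rwa [perm_apply_inv])
  obtain ⟨u, hu⟩ := exists_isTop hM (e - 1)
  have hur : u < r := by
    by_contra! hc
    rcases hc.lt_or_eq with hc | rfl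
    · have := hemin (w⁻¹ u) (by rwa [perm_apply_inv])
      have := hu.1
      omega
    · have := hu.1
      omega
  have hmin := h.min _ _ hu
  rcases lt_trichotomy e (w⁻¹ q) with heq | heq | heq
  · refine (hs e (w⁻¹ q) (w⁻¹ r) (w⁻¹ a) heq (by omega) har).2 ?_
    simp only [perm_apply_inv]
    omega
  · rw [heq, perm_apply_inv] at he
    omega
  have hqu := hu.2 q (by omega)
  obtain ⟨x, hex, hxk, hxu⟩ : ∃ x, e < x ∧ x ≤ k ∧ w x ≤ u := by
    by_contra! hc
    have hsub : (Finset.Icc e k).image w ⊆ (Finset.Ioc u b).erase r := by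
      intro y hy
      obtain ⟨x, hx, rfl⟩ := Finset.mem_image.1 hy
      rw [Finset.mem_Icc] at hx
      have h1 := h.top.2 (w x) (by rw [perm_inv_apply]; exact hx.2)
      rw [Finset.mem_erase, Finset.mem_Ioc]
      refine ⟨fun hxr => ?_, ?_, h1⟩
      · rw [← hxr, perm_inv_apply] at hr
        omega
      · rcases hx.1.lt_or_eq with h2 | rfl
        · exact hc x h2 hx.2
        · omega
    have hcard := Finset.card_le_card hsub
    rw [Finset.card_image_of_injective _ w.injective, Finset.card_erase_of_mem
      (Finset.mem_Ioc.2 ⟨hur, hrb.le⟩), Int.card_Icc, Int.card_Ioc] at hcard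
    omega
  have hxa : w x ≠ a := by
    intro hxa
    rw [← hxa, perm_inv_apply] at hA
    omega
  rcases hxa.lt_or_gt with hxa | hxa
  · refine (hs (w⁻¹ q) e x (w⁻¹ a) heq hex (by omega)).1 ?_
    simp only [perm_apply_inv]
    omega
  · refine (hs e x (w⁻¹ r) (w⁻¹ a) hex (by omega) har).2 ?_
    simp only [perm_apply_inv]
    omega

lemma IsAffinePerm.isCut_of_le (h : IsAffinePerm n w) (hn : 0 < n) {k y : ℤ}
    (hy : ∀ x, w⁻¹ x ≤ k ↔ x ≤ y) : IsCut w k := by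
  have hy' : ∀ j, w j ≤ y ↔ j ≤ k := fun j => by rw [← hy, perm_inv_apply]
  suffices y = k by
    intro j
    rw [← hy' j, this]
  have h1 := ((isAffinePerm_iff (k + 1)).1 h).2
  have hper := h.1
  have h2 : ∑ i ∈ Finset.Ico (k + 1) (k + 1 + n), w i =
      ∑ i ∈ Finset.Ico (k + 1) (k + 1 + n), (i + (y - k)) := by
    rw [← Finset.sum_image (f := fun x : ℤ => x) (g := w) (w.injective.injOn),
      ← Finset.sum_image (f := fun x : ℤ => x) (g := fun i => i + (y - k))
        (fun i _ j _ hij => by simpa using hij)]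
    congr 1
    ext x
    simp only [Finset.mem_image, Finset.mem_Ico]
    constructor
    · rintro ⟨i, hi, rfl⟩
      have e1 := hy' i
      have e2 := hy' (i - n)
      have e3 := hper (i - n)
      rw [sub_add_cancel] at e3
      exact ⟨w i - (y - k), by omega, by ring⟩
    · rintro ⟨i, hi, rfl⟩
      refine ⟨w⁻¹ (i + (y - k)), ?_, perm_apply_inv _ _⟩
      have e1 := hy' (w⁻¹ (i + (y - k)))
      have e2 := hy' (w⁻¹ (i + (y - k)) - n)
      have e3 := hper (w⁻¹ (i + (y - k)) - n)
      rw [sub_add_cancel] at e3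
      rw [perm_apply_inv] at e1 e3
      omega
  rw [Finset.sum_sub_distrib, h2, Finset.sum_add_distrib, add_sub_cancel_left, Finset.sum_const,
    Int.card_Ico, nsmul_eq_mul] at h1
  rcases mul_eq_zero.1 h1 with h1 | h1 <;> omega

end Extremal

/-- The values of `w` up to position `k` are those below `a` and those between `c` and `b`. -/
structure HasCorner (n : ℕ) (w : Equiv.Perm ℤ) (k a b c : ℤ) : Prop extends IsExtremal w k a b where
  lt : a < c
  le : c ≤ b
  lt_add : b < a + n
  mem : ∀ x, w⁻¹ x ≤ k ↔ x < a ∨ c ≤ x ∧ x ≤ b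

lemma IsAffinePerm.inv_add {n : ℕ} {w : Equiv.Perm ℤ} (h : IsAffinePerm n w) (x : ℤ) :
    w⁻¹ (x + n) = w⁻¹ x + n := by
  rw [Equiv.Perm.inv_eq_iff_eq, h.1, perm_apply_inv]

lemma exists_hasCorner {n : ℕ} {w : Equiv.Perm ℤ} (hn : 0 < n) (h : IsAffinePerm n w)
    (hs : SmoothPerm w) (hc : ∀ k, ¬ IsCut w k) : ∃ k a b c, HasCorner n w k a b c := by
  obtain ⟨M, hM⟩ := h.exists_bound hn
  obtain ⟨k, a, b, he⟩ := exists_isExtremal hM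
  have hA := he.gap.1
  have hB := he.top.1
  have hab : a < b := by
    by_contra! hab
    refine hc k (h.isCut_of_le hn (y := b) fun x => ⟨he.top.2 x, fun hx => ?_⟩)
    by_contra! hx2
    have := he.gap.2 x hx2
    obtain rfl : a = b := by omega
    omega
  obtain ⟨c, ⟨hac, hck⟩, hcmin⟩ := Int.exists_least_of_bdd (P := fun x => a < x ∧ w⁻¹ x ≤ k)
    ⟨a, fun x hx => hx.1.le⟩ ⟨b, hab, hB⟩
  have hcb := hcmin b ⟨hab, hB⟩
  have hmem : ∀ x, w⁻¹ x ≤ k ↔ x < a ∨ c ≤ x ∧ x ≤ b := by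
    intro x
    constructor
    · intro hx
      have h1 := he.top.2 x hx
      rcases lt_trichotomy x a with h2 | rfl | h2
      · exact Or.inl h2
      · omega
      · exact Or.inr ⟨hcmin x ⟨h2, hx⟩, h1⟩
    · rintro (hx | ⟨h1, h2⟩)
      · by_contra! hx2
        have := he.gap.2 x hx2
        omega
      · rcases h1.lt_or_eq with h1 | rfl
        · rcases h2.lt_or_eq with h2 | rfl
          · exact he.isUpper hs hM hac h1 h2 hck
          · exact hB
        · exact hck
  refine ⟨k, a, b, c, he, hac, hcb, ?_, hmem⟩
  have h1 := hmem (a + n)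
  rw [h.inv_add] at h1
  have h2 := h.inv_add (c - n)
  rw [sub_add_cancel] at h2
  have h3 := hmem (c - n)
  have h4 := hmem c
  omega

/-- The rank, among the values of a window of a permutation with a corner, of a value. -/
def cornerRank (n : ℕ) (a b c y : ℤ) : ℤ :=
  if y < c then y - a + 1 else if y < a + n then y - b + c - a else y - b

/-- The value with given rank, relative to the lowest one. -/
def cornerValue (n : ℕ) (d e v : ℤ) : ℤ :=
  if v ≤ d then v - 1 else if v ≤ n - 1 + d - e then v + e - d else v + e

section Corner

variable {n : ℕ} {w : Equiv.Perm ℤ} {k a b c : ℤ}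

lemma HasCorner.window_iff (h : HasCorner n w k a b c) (hw : IsAffinePerm n w) (y : ℤ) :
    (k < w⁻¹ y ∧ w⁻¹ y ≤ k + n) ↔
      (a ≤ y ∧ y < c) ∨ (b < y ∧ y < a + n) ∨ (c + n ≤ y ∧ y ≤ b + n) := by
  have h1 := h.mem y
  have h2 := h.mem (y - n)
  have h3 := hw.inv_add (y - n)
  rw [sub_add_cancel] at h3
  have := h.lt
  have := h.le
  have := h.lt_add
  omega

lemma cornerValue_cornerRank (h1 : a < c) (h2 : c ≤ b) (h3 : b < a + n) {y : ℤ}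
    (hy : (a ≤ y ∧ y < c) ∨ (b < y ∧ y < a + n) ∨ (c + n ≤ y ∧ y ≤ b + n)) :
    (1 ≤ cornerRank n a b c y ∧ cornerRank n a b c y ≤ n) ∧
      a + cornerValue n (c - a) (b - a) (cornerRank n a b c y) = y := by
  unfold cornerRank cornerValue
  split_ifs <;> omega

lemma cornerRank_cornerValue (h1 : a < c) (h2 : c ≤ b) {v : ℤ}
    (hv : 1 ≤ v ∧ v ≤ n) :
    let y := a + cornerValue n (c - a) (b - a) v
    ((a ≤ y ∧ y < c) ∨ (b < y ∧ y < a + n) ∨ (c + n ≤ y ∧ y ≤ b + n)) ∧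
      cornerRank n a b c y = v := by
  unfold cornerRank cornerValue
  dsimp only
  split_ifs <;> omega

lemma cornerValue_lt (h1 : a < c) (h2 : c ≤ b) {v v' : ℤ}
    (hv : v < v') :
    cornerValue n (c - a) (b - a) v < cornerValue n (c - a) (b - a) v' := by
  unfold cornerValue
  split_ifs <;> omega

lemma HasCorner.exists_isInd (h : HasCorner n w k a b c) (hw : IsAffinePerm n w) (hn : 0 < n)
    (hs : SmoothPerm w) (hc : ∀ k, ¬ IsCut w k) : ∃ u, IsInd n u ∧
      ∀ i : ℤ, 1 ≤ i → i ≤ n → w (k + i) = a + cornerValue n (c - a) (b - a) (u i) := by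
  have hlt := h.lt
  have hle := h.le
  have hadd := h.lt_add
  have hX := h.window_iff hw
  have hX' : ∀ i : ℤ, 1 ≤ i ∧ i ≤ n → _ := fun i hi =>
    (hX (w (k + i))).1 (by rw [perm_inv_apply]; omega)
  have hR := fun i hi => cornerValue_cornerRank hlt hle hadd (hX' i hi)
  have hV := fun v hv => cornerRank_cornerValue (n := n) (v := v) hlt hle hv
  let u : Equiv.Perm ℤ :=
    { toFun := fun i => if 1 ≤ i ∧ i ≤ n then cornerRank n a b c (w (k + i)) else i
      invFun := fun v => if 1 ≤ v ∧ v ≤ n then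
        w⁻¹ (a + cornerValue n (c - a) (b - a) v) - k else v
      left_inv := by
        intro i
        by_cases hi : 1 ≤ i ∧ i ≤ n
        · obtain ⟨h1, h2⟩ := hR i hi
          simp only [if_pos hi, if_pos h1, h2, perm_inv_apply, add_sub_cancel_left]
        · simp only [if_neg hi]
      right_inv := by
        intro v
        by_cases hv : 1 ≤ v ∧ v ≤ n
        · obtain ⟨h1, h2⟩ := hV v hv
          have h3 := (hX _).2 h1
          simp only [if_pos hv]
          rw [if_pos (by omega), add_sub_cancel, perm_apply_inv, h2]
        · simp only [if_neg hv] }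
  have hu1 : ∀ i : ℤ, 1 ≤ i ∧ i ≤ n → u i = cornerRank n a b c (w (k + i)) := fun i hi =>
    if_pos hi
  have hu2 : SuppIn n u := fun i hi => if_neg (by omega)
  have hwu : ∀ i : ℤ, 1 ≤ i ∧ i ≤ n → w (k + i) = a + cornerValue n (c - a) (b - a) (u i) :=
    fun i hi => by rw [hu1 i hi, (hR i hi).2]
  refine ⟨u, ⟨hu2, ?_, fun p hp1 hp2 => ?_⟩, fun i h1 h2 => hwu i ⟨h1, h2⟩⟩
  · refine hs.transfer (fun i => 1 ≤ i ∧ i ≤ n) (fun i => k + i) (fun i j => hu2.inversion)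
      (fun i j _ _ hij => by omega) fun i j hi hj hij => ?_
    rw [hwu i hi, hwu j hj]
    have := cornerValue_lt hlt hle (n := n) hij
    omega
  by_contra! hcon
  have hpres := hu2.preserves hcon
  have hmem : ∀ x, w⁻¹ x ≤ k + p ↔ w⁻¹ x ≤ k ∨
      (((a ≤ x ∧ x < c) ∨ (b < x ∧ x < a + n) ∨ (c + n ≤ x ∧ x ≤ b + n)) ∧
        cornerRank n a b c x ≤ p) := by
    intro x
    rw [← hX]
    by_cases hx : k < w⁻¹ x ∧ w⁻¹ x ≤ k + n
    · have h1 := hpres (w⁻¹ x - k)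
      rw [hu1 _ (by omega), add_sub_cancel, perm_apply_inv] at h1
      omega
    · omega
  have hpd : c - a < p := by
    have h1 := hcon 1 hp1
    rw [hu1 1 (by omega)] at h1
    have h2 := h.lt_succ
    have h3 := hX' 1 (by omega)
    unfold cornerRank at h1
    split_ifs at h1 <;> omega
  simp only [h.mem] at hmem
  by_cases hpm : p ≤ n - 1 + (c - a) - (b - a)
  · refine hc (k + p) (hw.isCut_of_le hn (y := p + b - c + a) fun x => ?_)
    rw [hmem]
    unfold cornerRank
    split_ifs <;> omega
  · have htop : IsTopValue w (k + p) (b + p) := by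
      refine ⟨?_, fun x hx => ?_⟩
      · rw [hmem]
        unfold cornerRank
        split_ifs <;> omega
      · rw [hmem] at hx
        unfold cornerRank at hx
        split_ifs at hx <;> omega
    have hgap : IsGapValue w (k + p) (a + n) := by
      refine ⟨?_, fun x hx => ?_⟩
      · rw [← not_le, hmem]
        unfold cornerRank
        split_ifs <;> omega
      · rw [← not_le, hmem] at hx
        unfold cornerRank at hx
        split_ifs at hx <;> omega
    have := h.tie _ _ _ htop hgap (by omega)
    omega

end Corner

/-- The smooth affine permutations without cuts. -/
def noCutAffine (n : ℕ) : Set (Equiv.Perm ℤ) :=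
  {w | (IsAffinePerm n w ∧ SmoothPerm w) ∧ ∀ k, ¬ IsCut w k}

lemma exists_code {n : ℕ} (hn : 0 < n) {w : Equiv.Perm ℤ} (hw : w ∈ noCutAffine n) :
    ∃ x : (ℕ × ℕ × ℕ) × Equiv.Perm ℤ,
      ((x.1.1 < n + 1 ∧ x.1.2.1 < n + 1 ∧ x.1.2.2 < n + 1) ∧ x.2 ∈ indSet n) ∧
      ∃ a : ℤ, ∀ i : ℤ, 1 ≤ i → i ≤ n →
        w (x.1.1 + i) = a + cornerValue n x.1.2.1 x.1.2.2 (x.2 i) := by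
  obtain ⟨⟨h1, h2⟩, h3⟩ := hw
  obtain ⟨k, a, b, c, h⟩ := exists_hasCorner hn h1 h2 h3
  obtain ⟨u, hu, hwu⟩ := h.exists_isInd h1 hn h2 h3
  have hlt := h.lt
  have hle := h.le
  have hadd := h.lt_add
  have hk := windowIdx_spec hn k
  refine ⟨(((k - n * windowIdx n k).toNat, (c - a).toNat, (b - a).toNat), u),
    ⟨by dsimp only; omega, mem_indSet.2 hu⟩, a - n * windowIdx n k, fun i hi hi' => ?_⟩
  simp only
  rw [Int.toNat_of_nonneg (by omega), Int.toNat_of_nonneg (by omega),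
    Int.toNat_of_nonneg (by omega)]
  have e1 := hwu i hi hi'
  have e2 := h1.apply_add_mul (k - n * windowIdx n k + i) (windowIdx n k)
  rw [show k - n * windowIdx n k + i + n * windowIdx n k = k + i by ring, e1] at e2
  linarith

lemma code_unique {n : ℕ} (hn : 0 < n) {v w : Equiv.Perm ℤ} (hv : IsAffinePerm n v)
    (hw : IsAffinePerm n w) {k a a' : ℤ} {f : ℤ → ℤ}
    (h1 : ∀ i : ℤ, 1 ≤ i → i ≤ n → v (k + i) = a + f i)
    (h2 : ∀ i : ℤ, 1 ≤ i → i ≤ n → w (k + i) = a' + f i) : v = w := by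
  have e : ∀ j ∈ Finset.Ico (k + 1) (k + 1 + n), v j - j = (w j - j) + (a - a') := by
    intro j hj
    rw [Finset.mem_Ico] at hj
    have e1 := h1 (j - k) (by omega) (by omega)
    have e2 := h2 (j - k) (by omega) (by omega)
    rw [add_sub_cancel] at e1 e2
    omega
  have s1 := ((isAffinePerm_iff (k + 1)).1 hv).2
  have s2 := ((isAffinePerm_iff (k + 1)).1 hw).2
  rw [Finset.sum_congr rfl e, Finset.sum_add_distrib, s2, zero_add, Finset.sum_const,
    Int.card_Ico, nsmul_eq_mul] at s1
  obtain rfl : a = a' := by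
    rcases mul_eq_zero.1 s1 with h | h <;> omega
  ext j
  have hj := windowIdx_spec hn (j - k)
  set q := windowIdx n (j - k)
  have e1 := hv.apply_add_mul (j - n * q) q
  have e2 := hw.apply_add_mul (j - n * q) q
  have e3 := h1 (j - k - n * q) hj.1 hj.2
  have e4 := h2 (j - k - n * q) hj.1 hj.2
  rw [show k + (j - k - n * q) = j - n * q by ring] at e3 e4
  rw [sub_add_cancel] at e1 e2
  rw [e1, e2, e3, e4]

lemma noCutAffine_bound {n : ℕ} (hn : 0 < n) : (noCutAffine n).Finite ∧
    (noCutAffine n).ncard ≤ (n + 1) ^ 3 * (indSet n).card := by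
  classical
  choose! f hf1 hf2 using fun w (hw : w ∈ noCutAffine n) => exists_code hn hw
  let T : Finset ((ℕ × ℕ × ℕ) × Equiv.Perm ℤ) :=
    (Finset.range (n + 1) ×ˢ Finset.range (n + 1) ×ˢ Finset.range (n + 1)) ×ˢ indSet n
  have hmaps : ∀ w ∈ noCutAffine n, f w ∈ (T : Set ((ℕ × ℕ × ℕ) × Equiv.Perm ℤ)) := by
    intro w hw
    have := hf1 w hw
    simpa [T] using this
  have hinj : Set.InjOn f (noCutAffine n) := by
    intro v hv w hw e
    obtain ⟨a, ha⟩ := hf2 v hv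
    obtain ⟨a', ha'⟩ := hf2 w hw
    rw [e] at ha
    exact code_unique hn hv.1.1 hw.1.1 ha ha'
  refine ⟨Set.Finite.of_injOn hmaps hinj T.finite_toSet, ?_⟩
  have := Set.ncard_le_ncard_of_injOn f hmaps hinj T.finite_toSet
  rw [Set.ncard_coe_finset] at this
  refine this.trans_eq ?_
  simp only [T, Finset.card_product, Finset.card_range]
  ring

lemma smoothCount_eq {n : ℕ} (hn : 0 < n) :
    smoothCount n = (cutAffine n).ncard + (noCutAffine n).ncard := by
  rw [← Set.ncard_union_eq ?_ (ncard_cutAffine_aux hn).2 (noCutAffine_bound hn).1]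
  · refine Nat.card_congr (Equiv.subtypeEquivRight fun w => ?_)
    rw [avoidsBoth_iff]
    by_cases h : ∃ k, IsCut w k
    · simp [cutAffine, noCutAffine, h]
    · simp only [not_exists] at h
      simp [cutAffine, noCutAffine, h]
  · rw [Set.disjoint_left]
    rintro w ⟨-, k, hk⟩ ⟨-, h⟩
    exact h k hk

theorem tendsto_smoothCount {α r : ℝ} (hr1 : 3 / 2 < r) (hr2 : r < 25 / 16)
    (hr3 : r ^ 3 - 2 * r ^ 2 + 2 * r - 2 = 0) (ha : α = (r - 1) / r ^ 2) :
    Tendsto (fun n : ℕ => (smoothCount n : ℝ) * α ^ n) atTop (𝓝 1) := by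
  have hα0 : 0 < α := by rw [ha]; exact div_pos (by linarith) (by positivity)
  have hα1 : α * (625 / 144) < 1 := by
    rw [ha, div_mul_eq_mul_div, div_lt_one (by positivity)]
    nlinarith
  obtain ⟨K, hK⟩ := treeRule_treeNodes.card_le
  have hind : ∀ k, 1 ≤ k → ((indSet k).card : ℝ) ≤ K * (625 / 144) ^ k := fun k hk => by
    rw [card_indSet]; exact hK k hk
  have hind' : ∀ k, 1 ≤ k → ((indSet k).card : ℝ) * α ^ k ≤ K * (α * (625 / 144)) ^ k := by
    intro k hk
    rw [mul_pow, mul_left_comm, mul_comm _ (α ^ k)]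
    exact mul_le_mul_of_nonneg_left (hind k hk) (by positivity)
  have hK0 : 0 ≤ K := by
    have := (Nat.cast_nonneg _).trans (hind 1 le_rfl)
    linarith
  set p : ℕ → ℝ := fun k => if k = 0 then 0 else (indSet k).card * α ^ k with hp
  have hps : ∀ k, p (k + 1) = (indSet (k + 1)).card * α ^ (k + 1) := fun k => if_neg (by omega)
  have hcut : Tendsto (fun n : ℕ => ((cutAffine n).ncard : ℝ) * α ^ n) atTop (𝓝 1) := by
    refine (renewal_tendsto (p := p) (r := fun n => (smoothSet n).card * α ^ n) (C := K)
      (θ := α * (625 / 144)) (if_pos rfl) (fun k => ?_) ?_ ?_ (by positivity) hα1 (fun k => ?_)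
      (by simp [card_smoothSet_zero]) fun n => ?_).congr' ?_
    · rw [hp]; dsimp only; split_ifs <;> positivity
    · rw [hps, card_indSet]; positivity
    · rw [← hasSum_nat_add_iff' 1]
      simp only [hps, Finset.sum_range_one, card_indSet]
      simpa [hp, mul_comm] using treeRule_treeNodes.hasSum hr1 hr2 hr3 ha
    · rcases k.eq_zero_or_pos with rfl | hk
      · simpa [hp] using hK0
      · rw [hp]; dsimp only
        rw [if_neg (by omega)]
        exact hind' k hk
    · rw [card_smoothSet_succ]
      push_cast
      rw [Finset.sum_mul]
      refine Finset.sum_congr rfl fun k hk => ?_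
      rw [hps]
      have : n + 1 = (k + 1) + (n - k) := by have := Finset.mem_range.1 hk; omega
      nth_rw 1 [this]
      rw [pow_add]; ring
    · filter_upwards [eventually_gt_atTop 0] with n hn
      rw [ncard_cutAffine hn]
      push_cast
      rw [Finset.sum_mul]
      refine Finset.sum_congr rfl fun k hk => ?_
      rcases k.eq_zero_or_pos with rfl | hk0
      · simp
      · rw [hp]; dsimp only
        rw [if_neg (by omega)]
        have : α ^ n = α ^ k * α ^ (n - k) := by
          rw [← pow_add]; congr 1; have := Finset.mem_range.1 hk; omega
        rw [this]; ring
  have hno : Tendsto (fun n : ℕ => ((noCutAffine n).ncard : ℝ) * α ^ n) atTop (𝓝 0) := by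
    have h1 := tendsto_pow_const_mul_const_pow_of_lt_one 3 (r := α * (625 / 144))
      (by positivity) hα1
    have h2 := h1.const_mul (8 * K)
    rw [mul_zero] at h2
    refine squeeze_zero' (Eventually.of_forall fun n => by positivity) ?_ h2
    filter_upwards [eventually_gt_atTop 0] with n hn
    have h3 : ((noCutAffine n).ncard : ℝ) ≤ (n + 1) ^ 3 * (indSet n).card := by
      exact_mod_cast (noCutAffine_bound hn).2
    have h4 : ((n : ℝ) + 1) ^ 3 ≤ (2 * n) ^ 3 := by
      have : (1 : ℝ) ≤ n := by exact_mod_cast hn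
      gcongr
      linarith
    calc ((noCutAffine n).ncard : ℝ) * α ^ n
        ≤ (n + 1) ^ 3 * (indSet n).card * α ^ n := by gcongr
      _ = (n + 1) ^ 3 * ((indSet n).card * α ^ n) := by ring
      _ ≤ (2 * n) ^ 3 * (K * (α * (625 / 144)) ^ n) :=
        mul_le_mul h4 (hind' n hn) (by positivity) (by positivity)
      _ = _ := by ring
  have := hcut.add hno
  rw [add_zero] at this
  refine this.congr' ?_
  filter_upwards [eventually_gt_atTop 0] with n hn
  rw [smoothCount_eq hn]
  push_cast
  ring

/-- Corollary 1.3 (`C:enum`): if `α` is the unique real root of `1 - 6t + 8t² - 4t³`,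
then the number `aₙ` of `3412`- and `4231`-avoiding affine permutations in `S̃ₙ`
satisfies `aₙ ~ α⁻ⁿ`, i.e. `aₙ · αⁿ → 1`. -/
theorem smooth_count_asymptotics (α : ℝ)
    (hroot : 1 - 6 * α + 8 * α ^ 2 - 4 * α ^ 3 = 0)
    (huniq : ∀ β : ℝ, 1 - 6 * β + 8 * β ^ 2 - 4 * β ^ 3 = 0 → β = α) :
    Filter.Tendsto (fun n : ℕ => (smoothCount n : ℝ) * α ^ n) Filter.atTop (nhds 1) := by
  obtain ⟨r, h1, h2, h3⟩ := exists_ratio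
  exact tendsto_smoothCount h1 h2 h3 (huniq _ (ratio_root h1 h3 rfl)).symm
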